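/- arXiv:1401.5595 — 2 statements merged into one kernel-verified Lean document; each statement's English description precedes it below -/
import Mathlib

section
/- Dixon–Anderson integral identity: Let m ≥ 1 be an integer, θ > 0 a real number, and let v_1 < v_2 < ⋯ < v_{m+1} be real numbers. Then the integral over the interlacing domain {(u_1,…,u_m) ∈ ℝ^m : v_1 < u_1 < v_2 < u_2 < ⋯ < u_m < v_{m+1}} of the function ∏_{1≤i<j≤m} (u_j − u_i) · ∏_{i=1}^m ∏_{j=1}^{m+1} |u_i − v_j|^{θ−1} with respect to Lebesgue measure du_1⋯du_m equals (Γ(θ)^{m+1} / Γ((m+1)θ)) · ∏_{1≤i<j≤m+1} (v_j − v_i)^{2θ−1}. -/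
open MeasureTheory Real

section Algebra

variable {n : ℕ}

theorem prod_Iio_sub_eq_det_vandermonde (x : Fin n → ℝ) :
    ∏ j, ∏ i ∈ Finset.Iio j, (x j - x i) = (Matrix.vandermonde x).det := by
  rw [Matrix.det_vandermonde]
  exact Finset.prod_comm' (by simp)

theorem prod_prod_erase_abs_sub (x : Fin n → ℝ) :
    ∏ j, ∏ k ∈ Finset.univ.erase j, |x j - x k| =
      |∏ j, ∏ i ∈ Finset.Iio j, (x j - x i)| ^ 2 := by
  have hsplit (j : Fin n) : ∏ k ∈ Finset.univ.erase j, |x j - x k| =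
      (∏ k ∈ Finset.Iio j, |x j - x k|) * ∏ k ∈ Finset.Ioi j, |x j - x k| := by
    rw [← Finset.prod_union (Finset.disjoint_left.2 fun a h₁ h₂ => by
      simp only [Finset.mem_Iio, Finset.mem_Ioi] at h₁ h₂; exact lt_asymm h₁ h₂)]
    refine Finset.prod_congr ?_ fun _ _ => rfl
    ext k
    simp
  have hswap : ∏ j, ∏ k ∈ Finset.Ioi j, |x j - x k| = ∏ j, ∏ k ∈ Finset.Iio j, |x j - x k| := by
    rw [Finset.prod_comm' (t' := Finset.univ) (s' := Finset.Iio) (by simp)]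
    exact Finset.prod_congr rfl fun j _ => Finset.prod_congr rfl fun k _ => abs_sub_comm _ _
  simp_rw [hsplit, Finset.prod_mul_distrib, hswap, Finset.abs_prod, sq]

theorem prod_succAbove_eq_prod_erase (g : Fin (n + 1) → ℝ) (j : Fin (n + 1)) :
    ∏ i, g (j.succAbove i) = ∏ k ∈ Finset.univ.erase j, g k := by
  rw [← Finset.compl_singleton, ← Fin.image_succAbove_univ,
    Finset.prod_image fun _ _ _ _ h => Fin.succAbove_right_injective h]

theorem prod_Iio_sub_succ (x : Fin (n + 1) → ℝ) :
    ∏ j, ∏ i ∈ Finset.Iio j, (x j - x i) =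
      (∏ j : Fin n, (x j.succ - x 0)) * ∏ j : Fin n, ∏ i ∈ Finset.Iio j, (x j.succ - x i.succ) := by
  rw [prod_Iio_sub_eq_det_vandermonde, prod_Iio_sub_eq_det_vandermonde (fun j : Fin n => x j.succ),
    Matrix.det_vandermonde, Matrix.det_vandermonde, Fin.prod_univ_succ]
  congr 1
  · rw [Fin.Ioi_zero_eq_map, Finset.prod_map]
    rfl
  · refine Finset.prod_congr rfl fun i _ => ?_
    rw [← Fin.map_succEmb_Ioi, Finset.prod_map]
    rfl

/-- The absolute value of the Cauchy determinant. -/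
theorem abs_det_inv_sub (x y : Fin n → ℝ) (hy : Function.Injective y)
    (hxy : ∀ j i, x j ≠ y i) :
    |(Matrix.of fun j i => (x j - y i)⁻¹).det| * ∏ j, ∏ i, |x j - y i| =
      |∏ j, ∏ i ∈ Finset.Iio j, (x j - x i)| * |∏ j, ∏ i ∈ Finset.Iio j, (y j - y i)| := by
  let p (i : Fin n) : Polynomial ℝ := Lagrange.nodal (Finset.univ.erase i) y
  let C : Matrix (Fin n) (Fin n) ℝ := Matrix.of fun k i => (p i).coeff k
  have hdeg (i : Fin n) : (p i).natDegree < n := by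
    have := i.pos
    simp only [p, Lagrange.natDegree_nodal, Finset.card_erase_of_mem (Finset.mem_univ i),
      Finset.card_univ, Fintype.card_fin]
    omega
  have hmul (z : Fin n → ℝ) :
      Matrix.vandermonde z * C = Matrix.of fun j i => (p i).eval (z j) := by
    ext j i
    rw [Matrix.mul_apply, Matrix.of_apply, Polynomial.eval_eq_sum_range' (hdeg i),
      ← Fin.sum_univ_eq_sum_range (fun k => (p i).coeff k * z j ^ k)]
    simp [C, mul_comm]
  have hdiag : (Matrix.of fun j i => (p i).eval (y j)) =
      Matrix.diagonal fun j => ∏ k ∈ Finset.univ.erase j, (y j - y k) := by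
    ext j i
    rw [Matrix.of_apply, Lagrange.eval_nodal]
    rcases eq_or_ne j i with rfl | h
    · rw [Matrix.diagonal_apply_eq]
    · rw [Matrix.diagonal_apply_ne _ h]
      exact Finset.prod_eq_zero (Finset.mem_erase.2 ⟨h, Finset.mem_univ _⟩) (sub_self _)
  have hVy : |(Matrix.vandermonde y).det| ≠ 0 :=
    abs_ne_zero.2 (Matrix.det_vandermonde_ne_zero_iff.2 hy)
  have hC : |C.det| = |(Matrix.vandermonde y).det| := by
    have h := congrArg (fun M => |Matrix.det M|) ((hmul y).trans hdiag)
    simp only [Matrix.det_mul, abs_mul, Matrix.det_diagonal, Finset.abs_prod] at h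
    rw [prod_prod_erase_abs_sub, prod_Iio_sub_eq_det_vandermonde, sq] at h
    exact mul_left_cancel₀ hVy h
  have hscale : (Matrix.of fun j i => (p i).eval (x j)) =
      Matrix.of fun j i => (∏ k, (x j - y k)) *
        (Matrix.of fun j i => (x j - y i)⁻¹ : Matrix (Fin n) (Fin n) ℝ) j i := by
    ext j i
    simp only [Matrix.of_apply, p, Lagrange.eval_nodal]
    rw [← Finset.mul_prod_erase _ _ (Finset.mem_univ i)]
    field_simp [sub_ne_zero.2 (hxy j i)]
  have h := congrArg (fun M => |Matrix.det M|) ((hmul x).trans hscale)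
  simp only [Matrix.det_mul, abs_mul, Matrix.det_mul_column, Finset.abs_prod, hC] at h
  rw [prod_Iio_sub_eq_det_vandermonde, prod_Iio_sub_eq_det_vandermonde, h, mul_comm]

end Algebra

section Interlacing

variable {m : ℕ}

/-- The points of `ℝ ^ m` that strictly interlace with `v`. -/
def interlacing (v : Fin (m + 1) → ℝ) : Set (Fin m → ℝ) :=
  {u | ∀ i : Fin m, v i.castSucc < u i ∧ u i < v i.succ}

/-- The residue at `v j` of the rational function `∏ i, (t - u i) / ∏ j, (t - v j)`. -/
noncomputable def residue (v : Fin (m + 1) → ℝ) (u : Fin m → ℝ) (j : Fin (m + 1)) : ℝ :=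
  ∏ i, (v j - u i) / (v j - v (j.succAbove i))

/-- The open corner simplex, the projection of the interior of the standard simplex. -/
def openCornerSimplex (m : ℕ) : Set (Fin m → ℝ) :=
  {y | (∀ i, 0 < y i) ∧ ∑ i, y i < 1}

variable {v : Fin (m + 1) → ℝ} {u : Fin m → ℝ}

theorem interlacing_lt (hv : StrictMono v) (hu : u ∈ interlacing v) {j : Fin (m + 1)} {i : Fin m}
    (h : i.castSucc < j) : u i < v j :=
  (hu i).2.trans_le (hv.monotone (Fin.castSucc_lt_iff_succ_le.1 h))

theorem lt_interlacing (hv : StrictMono v) (hu : u ∈ interlacing v) {j : Fin (m + 1)} {i : Fin m}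
    (h : j ≤ i.castSucc) : v j < u i :=
  (hv.monotone h).trans_lt (hu i).1

theorem ne_interlacing (hv : StrictMono v) (hu : u ∈ interlacing v) (j : Fin (m + 1)) (i : Fin m) :
    v j ≠ u i := by
  rcases lt_or_ge i.castSucc j with h | h
  · exact (interlacing_lt hv hu h).ne'
  · exact (lt_interlacing hv hu h).ne

theorem strictMono_interlacing (hv : StrictMono v) (hu : u ∈ interlacing v) : StrictMono u :=
  fun i _ h => (hu i).2.trans (lt_interlacing hv hu (Fin.succ_le_castSucc_iff.2 h))

theorem residue_pos (hv : StrictMono v) (hu : u ∈ interlacing v) (j : Fin (m + 1)) :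
    0 < residue v u j := by
  refine Finset.prod_pos fun i _ => ?_
  rcases lt_or_ge i.castSucc j with h | h
  · rw [Fin.succAbove_of_castSucc_lt _ _ h]
    exact div_pos (sub_pos.2 (interlacing_lt hv hu h)) (sub_pos.2 (hv h))
  · rw [Fin.succAbove_of_le_castSucc _ _ h]
    exact div_pos_of_neg_of_neg (sub_neg.2 (lt_interlacing hv hu h))
      (sub_neg.2 (hv (h.trans_lt i.castSucc_lt_succ)))

theorem residue_eq (v : Fin (m + 1) → ℝ) (u : Fin m → ℝ) (j : Fin (m + 1)) :
    residue v u j = (∏ i, (v j - u i)) / ∏ k ∈ Finset.univ.erase j, (v j - v k) := by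
  rw [residue, Finset.prod_div_distrib, prod_succAbove_eq_prod_erase (fun k => v j - v k)]

theorem prod_erase_sub_ne_zero (hv : Function.Injective v) (j : Fin (m + 1)) :
    ∏ k ∈ Finset.univ.erase j, (v j - v k) ≠ 0 :=
  Finset.prod_ne_zero_iff.2 fun _ hk => sub_ne_zero.2 (hv.ne (Finset.ne_of_mem_erase hk).symm)

theorem residue_mul (hv : Function.Injective v) (u : Fin m → ℝ) (j : Fin (m + 1)) :
    residue v u j * ∏ k ∈ Finset.univ.erase j, (v j - v k) = ∏ i, (v j - u i) := by
  rw [residue_eq, div_mul_cancel₀ _ (prod_erase_sub_ne_zero hv j)]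

theorem sum_residue (hv : Function.Injective v) (u : Fin m → ℝ) : ∑ j, residue v u j = 1 := by
  have h := Lagrange.leadingCoeff_eq_sum (s := Finset.univ) hv.injOn
    (P := Lagrange.nodal Finset.univ u) (by simp [Lagrange.degree_nodal])
  rw [Lagrange.nodal_monic.leadingCoeff] at h
  rw [h]
  exact Finset.sum_congr rfl fun j _ => by rw [residue_eq, Lagrange.eval_nodal]

theorem residue_zero (hv : Function.Injective v) (u : Fin m → ℝ) :
    residue v u 0 = 1 - ∑ j : Fin m, residue v u j.succ := by
  rw [← sum_residue hv u, Fin.sum_univ_succ]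
  ring

theorem injOn_residue (hv : StrictMono v) :
    Set.InjOn (fun u (j : Fin m) => residue v u j.succ) (interlacing v) := by
  intro a ha b hb hab
  have hpoly : Lagrange.nodal Finset.univ a = Lagrange.nodal Finset.univ b := by
    refine Polynomial.eq_of_degree_le_of_eval_index_eq Finset.univ
      (v := fun j : Fin m => v j.succ) (hv.injective.comp (Fin.succ_injective m)).injOn
      (by simp [Lagrange.degree_nodal]) (by simp [Lagrange.degree_nodal]) ?_ fun j _ => ?_
    · rw [Lagrange.nodal_monic.leadingCoeff, Lagrange.nodal_monic.leadingCoeff]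
    · rw [Lagrange.eval_nodal, Lagrange.eval_nodal, ← residue_mul hv.injective,
        ← residue_mul hv.injective]
      exact congrArg (· * _) (congrFun hab j)
  funext i
  have h0 : (Lagrange.nodal Finset.univ b).eval (a i) = 0 := by
    rw [← hpoly, Lagrange.eval_nodal_at_node (Finset.mem_univ i)]
  rw [Lagrange.eval_nodal, Finset.prod_eq_zero_iff] at h0
  obtain ⟨k, -, hk⟩ := h0
  rw [sub_eq_zero] at hk
  have hki : k = i := by
    rcases lt_trichotomy k i with h | h | h
    · have := lt_interlacing hv ha (Fin.succ_le_castSucc_iff.2 h)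
      have := (hb k).2
      linarith
    · exact h
    · have := lt_interlacing hv hb (Fin.succ_le_castSucc_iff.2 h)
      have := (ha i).2
      linarith
  rw [hk, hki]

/-- Every family of positive weights with sum one is the family of residues attached to an
interlacing point. -/
theorem exists_interlacing_residue_eq (hv : StrictMono v) {c : Fin (m + 1) → ℝ}
    (hc : ∀ j, 0 < c j) (hsum : ∑ j, c j = 1) : ∃ u ∈ interlacing v, residue v u = c := by
  classical
  let P : Polynomial ℝ :=
    ∑ j, Polynomial.C (c j) * Lagrange.nodal (Finset.univ.erase j) v
  have hcard (j : Fin (m + 1)) : (Finset.univ.erase j).card = m := by simp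
  have hPdeg : P.natDegree ≤ m := by
    refine Polynomial.natDegree_sum_le_of_forall_le _ _ fun j _ => ?_
    refine (Polynomial.natDegree_C_mul_le _ _).trans ?_
    rw [Lagrange.natDegree_nodal, hcard]
  have hPcoeff : P.coeff m = 1 := by
    rw [Polynomial.finsetSum_coeff, ← hsum]
    refine Finset.sum_congr rfl fun j _ => ?_
    have h := (Lagrange.nodal_monic (s := Finset.univ.erase j) (v := v)).coeff_natDegree
    rw [Lagrange.natDegree_nodal, hcard] at h
    rw [Polynomial.coeff_C_mul, h, mul_one]
  have hPmonic : P.Monic := Polynomial.monic_of_natDegree_le_of_coeff_eq_one m hPdeg hPcoeff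
  have hPnat : P.natDegree = m :=
    hPdeg.antisymm (Polynomial.le_natDegree_of_ne_zero (by rw [hPcoeff]; exact one_ne_zero))
  have hPeval (j : Fin (m + 1)) :
      P.eval (v j) = c j * ∏ k ∈ Finset.univ.erase j, (v j - v k) := by
    rw [Polynomial.eval_finsetSum, Finset.sum_eq_single j]
    · rw [Polynomial.eval_mul, Polynomial.eval_C, Lagrange.eval_nodal]
    · intro k _ hk
      rw [Polynomial.eval_mul, Lagrange.eval_nodal_at_node, mul_zero]
      exact Finset.mem_erase.2 ⟨hk.symm, Finset.mem_univ _⟩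
    · simp
  have hsign (i : Fin m) : P.eval (v i.castSucc) * P.eval (v i.succ) < 0 := by
    rw [hPeval, hPeval, mul_mul_mul_comm]
    refine mul_neg_of_pos_of_neg (mul_pos (hc _) (hc _)) ?_
    rw [← prod_succAbove_eq_prod_erase (fun k => v i.castSucc - v k),
      ← prod_succAbove_eq_prod_erase (fun k => v i.succ - v k), ← Finset.prod_mul_distrib,
      ← Finset.mul_prod_erase _ _ (Finset.mem_univ i)]
    refine mul_neg_of_neg_of_pos ?_ (Finset.prod_pos fun k hk => ?_)
    · rw [Fin.succAbove_of_le_castSucc _ _ le_rfl,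
        Fin.succAbove_of_castSucc_lt _ _ i.castSucc_lt_succ]
      have := hv i.castSucc_lt_succ
      nlinarith
    · rcases (Finset.ne_of_mem_erase hk).lt_or_gt with h | h
      · have h₁ : k.castSucc < i.castSucc := h
        have h₂ := h₁.trans i.castSucc_lt_succ
        rw [Fin.succAbove_of_castSucc_lt _ _ h₁, Fin.succAbove_of_castSucc_lt _ _ h₂]
        exact mul_pos (sub_pos.2 (hv h₁)) (sub_pos.2 (hv h₂))
      · have h₁ : i.succ ≤ k.castSucc := Fin.succ_le_castSucc_iff.2 h
        have h₂ := i.castSucc_lt_succ.trans_le h₁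
        rw [Fin.succAbove_of_le_castSucc _ _ h₂.le, Fin.succAbove_of_le_castSucc _ _ h₁]
        exact mul_pos_of_neg_of_neg (sub_neg.2 (hv (h₂.trans k.castSucc_lt_succ)))
          (sub_neg.2 (hv (h₁.trans_lt k.castSucc_lt_succ)))
  have hroot (i : Fin m) : ∃ t ∈ Set.Ioo (v i.castSucc) (v i.succ), P.eval t = 0 := by
    have hle := (hv i.castSucc_lt_succ).le
    rcases mul_neg_iff.1 (hsign i) with h | h
    · exact intermediate_value_Ioo' hle P.continuous.continuousOn ⟨h.2, h.1⟩
    · exact intermediate_value_Ioo hle P.continuous.continuousOn h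
  choose u hu hu0 using hroot
  have hmem : u ∈ interlacing v := hu
  refine ⟨u, hmem, ?_⟩
  have hpoly : P = Lagrange.nodal Finset.univ u := by
    have hdeg : P.degree = m := by
      rw [Polynomial.degree_eq_natDegree hPmonic.ne_zero, hPnat]
    refine Polynomial.eq_of_degree_le_of_eval_index_eq Finset.univ (v := u)
      (strictMono_interlacing hv hmem).injective.injOn
      (by simp [hdeg]) (by simp [Lagrange.degree_nodal, hdeg]) ?_ fun i hi => ?_
    · rw [hPmonic.leadingCoeff, Lagrange.nodal_monic.leadingCoeff]
    · rw [hu0, Lagrange.eval_nodal_at_node hi]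
  funext j
  rw [residue_eq, ← Lagrange.eval_nodal, ← hpoly, hPeval,
    mul_div_cancel_right₀ _ (prod_erase_sub_ne_zero hv.injective j)]

theorem image_residue (hv : StrictMono v) :
    (fun u (j : Fin m) => residue v u j.succ) '' interlacing v = openCornerSimplex m := by
  ext y
  constructor
  · rintro ⟨u, hu, rfl⟩
    refine ⟨fun j => residue_pos hv hu _, ?_⟩
    have h := residue_pos hv hu 0
    rw [residue_zero hv.injective] at h
    exact sub_pos.1 h
  · rintro ⟨hpos, hlt⟩
    obtain ⟨u, hu, h⟩ := exists_interlacing_residue_eq hv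
      (c := (Fin.cons (1 - ∑ i, y i) y : Fin (m + 1) → ℝ))
      (Fin.cases (by simpa using hlt) (by simpa using hpos)) (by simp [Fin.sum_univ_succ])
    exact ⟨u, hu, funext fun j => by simp [h]⟩

theorem hasFDerivAt_residue (hv : StrictMono v) (hu : u ∈ interlacing v) :
    HasFDerivAt (fun u (j : Fin m) => residue v u j.succ)
      (Matrix.toLin' (Matrix.of fun j i : Fin m =>
        -residue v u j.succ * (v j.succ - u i)⁻¹)).toContinuousLinearMap u := by
  rw [hasFDerivAt_pi']
  intro j
  have h := HasFDerivAt.finsetProd (u := Finset.univ) (x := u)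
    (g := fun i (u : Fin m → ℝ) => (v j.succ - u i) / (v j.succ - v (j.succ.succAbove i)))
    (g' := fun i => (v j.succ - v (j.succ.succAbove i))⁻¹ •
      -(ContinuousLinearMap.proj i : (Fin m → ℝ) →L[ℝ] ℝ))
    fun i _ => by
      simp_rw [div_eq_inv_mul]
      exact ((ContinuousLinearMap.proj (R := ℝ) (φ := fun _ : Fin m => ℝ) i).hasFDerivAt.const_sub
        (v j.succ)).const_mul _
  refine h.congr_fderiv ?_
  ext w
  simp only [sum_apply, smul_apply,
    neg_apply, ContinuousLinearMap.proj_apply, smul_eq_mul,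
    ContinuousLinearMap.comp_apply, LinearMap.coe_toContinuousLinearMap', Matrix.toLin'_apply,
    Matrix.mulVec, dotProduct, Matrix.of_apply]
  refine Finset.sum_congr rfl fun i _ => ?_
  have hne := sub_ne_zero.2 (ne_interlacing hv hu j.succ i)
  rw [residue, ← Finset.mul_prod_erase _ _ (Finset.mem_univ i)]
  field_simp

theorem prod_residue_mul (hv : StrictMono v) (hu : u ∈ interlacing v) :
    (∏ j, residue v u j) * (∏ j, ∏ i ∈ Finset.Iio j, (v j - v i)) ^ 2 =
      ∏ i, ∏ j, |u i - v j| := by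
  rw [← sq_abs, ← prod_prod_erase_abs_sub, ← Finset.prod_mul_distrib, Finset.prod_comm]
  refine Finset.prod_congr rfl fun j _ => ?_
  rw [← Finset.abs_prod, ← abs_of_pos (residue_pos hv hu j), ← abs_mul, residue_mul hv.injective,
    Finset.abs_prod]
  exact Finset.prod_congr rfl fun i _ => abs_sub_comm _ _

theorem prod_Iio_sub_pos {n : ℕ} {x : Fin n → ℝ} (hx : StrictMono x) :
    0 < ∏ j, ∏ i ∈ Finset.Iio j, (x j - x i) :=
  Finset.prod_pos fun _ _ => Finset.prod_pos fun _ hi => sub_pos.2 (hx (Finset.mem_Iio.1 hi))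

theorem abs_det_fderiv_residue_mul (hv : StrictMono v) (hu : u ∈ interlacing v) :
    |(Matrix.toLin' (Matrix.of fun j i : Fin m =>
        -residue v u j.succ * (v j.succ - u i)⁻¹)).toContinuousLinearMap.det| *
      (∏ j, ∏ i ∈ Finset.Iio j, (v j - v i)) = ∏ j, ∏ i ∈ Finset.Iio j, (u j - u i) := by
  have hvs : StrictMono fun j : Fin m => v j.succ := hv.comp (Fin.strictMono_succ)
  have hus := strictMono_interlacing hv hu
  have hC := abs_det_inv_sub (fun j => v j.succ) u hus.injective
    fun j i => ne_interlacing hv hu j.succ i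
  rw [abs_of_pos (prod_Iio_sub_pos hvs), abs_of_pos (prod_Iio_sub_pos hus)] at hC
  have hM : |(Matrix.toLin' (Matrix.of fun j i : Fin m =>
      -residue v u j.succ * (v j.succ - u i)⁻¹)).toContinuousLinearMap.det| =
      (∏ j : Fin m, residue v u j.succ) *
        |(Matrix.of fun j i : Fin m => (v j.succ - u i)⁻¹).det| := by
    have h := Matrix.det_mul_column (fun j : Fin m => -residue v u j.succ)
      (Matrix.of fun j i : Fin m => (v j.succ - u i)⁻¹)
    simp only [Matrix.of_apply] at h
    rw [ContinuousLinearMap.det, LinearMap.coe_toContinuousLinearMap, LinearMap.det_toLin', h,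
      abs_mul, Finset.abs_prod]
    congr 1
    exact Finset.prod_congr rfl fun j _ => by rw [abs_neg, abs_of_pos (residue_pos hv hu _)]
  have hw : (∏ j : Fin m, residue v u j.succ) *
      ∏ j : Fin m, ∏ k ∈ Finset.univ.erase j.succ, |v j.succ - v k| =
      ∏ j : Fin m, ∏ i, |v j.succ - u i| := by
    rw [← Finset.prod_mul_distrib]
    refine Finset.prod_congr rfl fun j _ => ?_
    rw [← Finset.abs_prod, ← Finset.abs_prod, ← residue_mul hv.injective, abs_mul,
      abs_of_pos (residue_pos hv hu _)]
  have hE : ∏ j : Fin m, ∏ k ∈ Finset.univ.erase j.succ, |v j.succ - v k| =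
      (∏ j, ∏ i ∈ Finset.Iio j, (v j - v i)) *
        ∏ j : Fin m, ∏ i ∈ Finset.Iio j, (v j.succ - v i.succ) := by
    have h0 : ∏ k ∈ Finset.univ.erase 0, |v 0 - v k| = ∏ j : Fin m, (v j.succ - v 0) := by
      rw [← prod_succAbove_eq_prod_erase (fun k => |v 0 - v k|)]
      refine Finset.prod_congr rfl fun j _ => ?_
      rw [Fin.succAbove_zero, abs_sub_comm, abs_of_pos (sub_pos.2 (hv j.succ_pos))]
    have hpos : 0 < ∏ j : Fin m, (v j.succ - v 0) :=
      Finset.prod_pos fun j _ => sub_pos.2 (hv j.succ_pos)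
    have h := prod_prod_erase_abs_sub v
    rw [Fin.prod_univ_succ, h0, sq_abs, sq] at h
    nth_rewrite 2 [prod_Iio_sub_succ] at h
    refine mul_left_cancel₀ hpos.ne' (h.trans ?_)
    ring
  have hVs := prod_Iio_sub_pos hvs
  have hpos : 0 < ∏ j : Fin m, ∏ i, |v j.succ - u i| :=
    Finset.prod_pos fun j _ => Finset.prod_pos fun i _ =>
      abs_pos.2 (sub_ne_zero.2 (ne_interlacing hv hu _ _))
  rw [hE] at hw
  rw [hM]
  refine mul_right_cancel₀ (mul_pos hVs hpos).ne' ?_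
  linear_combination (∏ j : Fin m, residue v u j.succ) *
    (∏ j, ∏ i ∈ Finset.Iio j, (v j - v i)) *
    (∏ j : Fin m, ∏ i ∈ Finset.Iio j, (v j.succ - v i.succ)) * hC +
    (∏ j : Fin m, ∏ i ∈ Finset.Iio j, (v j.succ - v i.succ)) *
    (∏ j, ∏ i ∈ Finset.Iio j, (u j - u i)) * hw

end Interlacing

section Dirichlet

/-- The density `x ^ (θ - 1)` on the positive half-line, as an extended nonnegative function. -/
noncomputable def powDensity (θ x : ℝ) : ENNReal :=
  (Set.Ioi 0).indicator (fun x => ENNReal.ofReal (x ^ (θ - 1))) x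

theorem measurable_powDensity (θ : ℝ) : Measurable (powDensity θ) :=
  Measurable.indicator (by fun_prop) measurableSet_Ioi

theorem powDensity_of_pos {θ x : ℝ} (hx : 0 < x) :
    powDensity θ x = ENNReal.ofReal (x ^ (θ - 1)) :=
  Set.indicator_of_mem hx _

theorem powDensity_of_nonpos {θ x : ℝ} (hx : x ≤ 0) : powDensity θ x = 0 :=
  Set.indicator_of_notMem (by simpa using hx) _

theorem prod_powDensity_eq_zero {m : ℕ} (θ : ℝ) {y : Fin m → ℝ} {i : Fin m} (hi : y i ≤ 0) :
    ∏ i, powDensity θ (y i) = 0 :=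
  Finset.prod_eq_zero (i := i) (Finset.mem_univ i) (powDensity_of_nonpos hi)

theorem powDensity_mul {s : ℝ} (hs : 0 < s) (θ x : ℝ) :
    powDensity θ (s * x) = ENNReal.ofReal (s ^ (θ - 1)) * powDensity θ x := by
  rcases le_or_gt x 0 with hx | hx
  · rw [powDensity_of_nonpos hx, powDensity_of_nonpos (mul_nonpos_of_nonneg_of_nonpos hs.le hx),
      mul_zero]
  · rw [powDensity_of_pos hx, powDensity_of_pos (mul_pos hs hx), mul_rpow hs.le hx.le,
      ENNReal.ofReal_mul (by positivity)]

theorem lintegral_exp_neg_mul_powDensity {θ : ℝ} (hθ : 0 < θ) :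
    ∫⁻ t, ENNReal.ofReal (exp (-t)) * powDensity θ t = ENNReal.ofReal (Gamma θ) := by
  have h (t : ℝ) : ENNReal.ofReal (exp (-t)) * powDensity θ t =
      (Set.Ioi 0).indicator (fun t => ENNReal.ofReal (exp (-t) * t ^ (θ - 1))) t := by
    simp only [powDensity, Set.indicator_apply, ENNReal.ofReal_mul (exp_pos _).le, mul_ite,
      mul_zero]
  simp_rw [h]
  rw [lintegral_indicator measurableSet_Ioi, Gamma_eq_integral hθ,
    ofReal_integral_eq_lintegral_ofReal (GammaIntegral_convergent hθ)]
  filter_upwards [self_mem_ae_restrict measurableSet_Ioi] with t ht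
  have : (0 : ℝ) < t := ht
  simp only [Pi.zero_apply]
  positivity

theorem lintegral_pi_prod_eq_pow {f : ℝ → ENNReal} (hf : Measurable f) (m : ℕ) :
    ∫⁻ y : Fin m → ℝ, ∏ i, f (y i) = (∫⁻ t, f t) ^ m := by
  induction m with
  | zero => simp [volume_pi]
  | succ m ih =>
    rw [← (volume_preserving_piFinSuccAbove (fun _ => ℝ) 0).symm.lintegral_comp (by fun_prop)]
    simp only [MeasurableEquiv.piFinSuccAbove_symm_apply, Fin.insertNthEquiv,
      Fin.prod_univ_succ, Fin.insertNth_zero, Equiv.coe_fn_mk, Fin.cons_succ, Fin.cons_zero,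
      cast_eq]
    have hprod : Measurable fun y : Fin m → ℝ => ∏ i, f (y i) := by fun_prop
    rw [Measure.volume_eq_prod, lintegral_prod_mul hf.aemeasurable hprod.aemeasurable, ih,
      pow_succ']

/-- The Dirichlet integral over the corner simplex of size `s`. -/
noncomputable def dirichletIntegral (m : ℕ) (θ s : ℝ) : ENNReal :=
  ∫⁻ y : Fin m → ℝ, (∏ i, powDensity θ (y i)) * powDensity θ (s - ∑ i, y i)

theorem dirichletIntegral_of_nonpos (m : ℕ) (θ : ℝ) {s : ℝ} (hs : s ≤ 0) :
    dirichletIntegral m θ s = 0 := by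
  rw [dirichletIntegral, lintegral_eq_zero_of_ae_eq_zero]
  refine Filter.Eventually.of_forall fun y => ?_
  by_cases hy : ∀ i, 0 < y i
  · have := Finset.sum_nonneg fun i (_ : i ∈ Finset.univ) => (hy i).le
    simp [powDensity_of_nonpos (show s - ∑ i, y i ≤ 0 by linarith)]
  · push Not at hy
    obtain ⟨i, hi⟩ := hy
    simp [prod_powDensity_eq_zero θ hi]

theorem dirichletIntegral_of_pos (m : ℕ) (θ : ℝ) {s : ℝ} (hs : 0 < s) :
    dirichletIntegral m θ s =
      ENNReal.ofReal (s ^ (((m : ℝ) + 1) * θ - 1)) * dirichletIntegral m θ 1 := by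
  have hmeas : Measurable fun y : Fin m → ℝ =>
      (∏ i, powDensity θ (y i)) * powDensity θ (s - ∑ i, y i) := by
    have := measurable_powDensity θ
    fun_prop
  have hmeas₁ : Measurable fun y : Fin m → ℝ =>
      (∏ i, powDensity θ (y i)) * powDensity θ (1 - ∑ i, y i) := by
    have := measurable_powDensity θ
    fun_prop
  have hscale (y : Fin m → ℝ) :
      (∏ i, powDensity θ ((s • y) i)) * powDensity θ (s - ∑ i, (s • y) i) =
        ENNReal.ofReal ((s ^ (θ - 1)) ^ (m + 1)) *
          ((∏ i, powDensity θ (y i)) * powDensity θ (1 - ∑ i, y i)) := by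
    have h : s - ∑ i, (s • y) i = s * (1 - ∑ i, y i) := by
      simp only [Pi.smul_apply, smul_eq_mul, ← Finset.mul_sum]
      ring
    rw [h, powDensity_mul hs]
    simp only [Pi.smul_apply, smul_eq_mul, powDensity_mul hs, Finset.prod_mul_distrib,
      Finset.prod_const, Finset.card_univ, Fintype.card_fin]
    rw [ENNReal.ofReal_pow (by positivity)]
    ring
  have hmap := Measure.map_addHaar_smul (volume : Measure (Fin m → ℝ)) hs.ne'
  rw [Module.finrank_fintype_fun_eq_card, Fintype.card_fin,
    abs_of_pos (inv_pos.2 (pow_pos hs m))] at hmap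
  have h := lintegral_map (μ := volume) hmeas (measurable_const_smul s)
  simp_rw [hscale] at h
  rw [hmap, lintegral_smul_measure, lintegral_const_mul _ hmeas₁, smul_eq_mul] at h
  change ENNReal.ofReal (s ^ m)⁻¹ * dirichletIntegral m θ s =
    _ * dirichletIntegral m θ 1 at h
  have hinv : ENNReal.ofReal (s ^ m) * ENNReal.ofReal (s ^ m)⁻¹ = 1 := by
    rw [← ENNReal.ofReal_mul (by positivity), mul_inv_cancel₀ (by positivity), ENNReal.ofReal_one]
  rw [← one_mul (dirichletIntegral m θ s), ← hinv, mul_assoc, h, ← mul_assoc,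
    ← ENNReal.ofReal_mul (by positivity), ← rpow_natCast s, ← rpow_natCast (s ^ (θ - 1)),
    ← rpow_mul hs.le, ← rpow_add hs]
  congr 3
  push_cast
  ring

theorem dirichletIntegral_mul_Gamma (m : ℕ) {θ : ℝ} (hθ : 0 < θ) :
    ENNReal.ofReal (Gamma (((m : ℝ) + 1) * θ)) * dirichletIntegral m θ 1 =
      ENNReal.ofReal (Gamma θ) ^ (m + 1) := by
  have hmeas := measurable_powDensity θ
  let F (s : ℝ) (y : Fin m → ℝ) : ENNReal :=
    ENNReal.ofReal (exp (-s)) * ((∏ i, powDensity θ (y i)) * powDensity θ (s - ∑ i, y i))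
  have hF : Measurable (Function.uncurry F) := by
    unfold F Function.uncurry
    fun_prop
  have hleft : ∫⁻ s, ∫⁻ y, F s y =
      ENNReal.ofReal (Gamma (((m : ℝ) + 1) * θ)) * dirichletIntegral m θ 1 := by
    rw [← lintegral_exp_neg_mul_powDensity (by positivity),
      ← lintegral_mul_const _ (by have := measurable_powDensity (((m : ℝ) + 1) * θ); fun_prop)]
    refine lintegral_congr fun s => ?_
    rw [lintegral_const_mul _ (by fun_prop)]
    change _ * dirichletIntegral m θ s = _
    rcases le_or_gt s 0 with hs | hs
    · rw [dirichletIntegral_of_nonpos m θ hs, powDensity_of_nonpos hs, mul_zero, zero_mul]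
    · rw [dirichletIntegral_of_pos m θ hs, powDensity_of_pos hs, mul_assoc]
  have hright : ∫⁻ y, ∫⁻ s, F s y = ENNReal.ofReal (Gamma θ) ^ (m + 1) := by
    have hinner (y : Fin m → ℝ) : ∫⁻ s, F s y =
        (∏ i, ENNReal.ofReal (exp (-y i)) * powDensity θ (y i)) * ENNReal.ofReal (Gamma θ) := by
      rw [← lintegral_exp_neg_mul_powDensity hθ, ← lintegral_const_mul _ (by fun_prop)]
      refine Eq.trans ?_ (lintegral_sub_right_eq_self _ (∑ i, y i))
      refine lintegral_congr fun s => ?_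
      have hexp : ENNReal.ofReal (exp (-s)) = (∏ i, ENNReal.ofReal (exp (-y i))) *
          ENNReal.ofReal (exp (-(s - ∑ i, y i))) := by
        rw [← ENNReal.ofReal_prod_of_nonneg fun _ _ => (exp_pos _).le,
          ← ENNReal.ofReal_mul (Finset.prod_nonneg fun _ _ => (exp_pos _).le), ← exp_sum,
          ← exp_add, Finset.sum_neg_distrib]
        congr 2
        ring
      simp only [F, hexp, Finset.prod_mul_distrib]
      ring
    simp_rw [hinner]
    rw [lintegral_mul_const _ (by fun_prop),
      lintegral_pi_prod_eq_pow (f := fun t => ENNReal.ofReal (exp (-t)) * powDensity θ t)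
        (by fun_prop), lintegral_exp_neg_mul_powDensity hθ, pow_succ]
  rw [← hleft, lintegral_lintegral_swap hF.aemeasurable, hright]

theorem measurableSet_openCornerSimplex (m : ℕ) : MeasurableSet (openCornerSimplex m) := by
  unfold openCornerSimplex
  measurability

/-- The Dirichlet integral with all parameters equal to `θ`. -/
theorem integral_openCornerSimplex (m : ℕ) {θ : ℝ} (hθ : 0 < θ) :
    ∫ y in openCornerSimplex m, ((1 - ∑ i, y i) * ∏ i, y i) ^ (θ - 1) =
      Gamma θ ^ (m + 1) / Gamma (((m : ℝ) + 1) * θ) := by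
  have hlintegral : ∫⁻ y in openCornerSimplex m,
      ENNReal.ofReal (((1 - ∑ i, y i) * ∏ i, y i) ^ (θ - 1)) = dirichletIntegral m θ 1 := by
    rw [← lintegral_indicator (measurableSet_openCornerSimplex m)]
    refine lintegral_congr fun y => ?_
    by_cases hy : y ∈ openCornerSimplex m
    · have h₁ : 0 < 1 - ∑ i, y i := sub_pos.2 hy.2
      rw [Set.indicator_of_mem hy, powDensity_of_pos h₁,
        Finset.prod_congr rfl fun i _ => powDensity_of_pos (hy.1 i),
        ← ENNReal.ofReal_prod_of_nonneg fun i _ => rpow_nonneg (hy.1 i).le _,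
        mul_rpow h₁.le (Finset.prod_nonneg fun i _ => (hy.1 i).le),
        ← finsetProd_rpow _ _ fun i _ => (hy.1 i).le, mul_comm,
        ENNReal.ofReal_mul (Finset.prod_nonneg fun i _ => rpow_nonneg (hy.1 i).le _)]
    · rw [Set.indicator_of_notMem hy]
      symm
      by_cases hpos : ∀ i, 0 < y i
      · have hle : 1 - ∑ i, y i ≤ 0 := sub_nonpos.2 (not_lt.1 fun h => hy ⟨hpos, h⟩)
        rw [powDensity_of_nonpos hle, mul_zero]
      · push Not at hpos
        obtain ⟨i, hi⟩ := hpos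
        rw [prod_powDensity_eq_zero θ hi, zero_mul]
  rw [integral_eq_lintegral_of_nonneg_ae, hlintegral]
  · have hΓ : 0 < Gamma (((m : ℝ) + 1) * θ) := Gamma_pos_of_pos (by positivity)
    have h := congrArg ENNReal.toReal (dirichletIntegral_mul_Gamma m hθ)
    rw [ENNReal.toReal_mul, ENNReal.toReal_pow, ENNReal.toReal_ofReal hΓ.le,
      ENNReal.toReal_ofReal (Gamma_pos_of_pos hθ).le] at h
    rw [eq_div_iff hΓ.ne', ← h, mul_comm]
  · filter_upwards [self_mem_ae_restrict (measurableSet_openCornerSimplex m)] with y hy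
    exact rpow_nonneg (mul_nonneg (sub_pos.2 hy.2).le (Finset.prod_nonneg fun i _ => (hy.1 i).le)) _
  · exact Measurable.aestronglyMeasurable (by fun_prop)

end Dirichlet

theorem measurableSet_interlacing {m : ℕ} (v : Fin (m + 1) → ℝ) :
    MeasurableSet (interlacing v) := by
  unfold interlacing
  measurability

/-- **Dixon–Anderson integral identity.** For `v_1 < ⋯ < v_{m+1}` the integral over the
interlacing domain `{v_1 < u_1 < v_2 < ⋯ < u_m < v_{m+1}}` of
`∏_{i<j}(u_j−u_i) ∏_i ∏_j |u_i−v_j|^{θ−1}` equals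
`Γ(θ)^{m+1}/Γ((m+1)θ) ∏_{i<j}(v_j−v_i)^{2θ−1}`. -/
theorem dixon_anderson (m : ℕ) (hm : 1 ≤ m) (θ : ℝ) (hθ : 0 < θ)
    (v : Fin (m + 1) → ℝ) (hv : StrictMono v) :
    (∫ u : Fin m → ℝ in {u | ∀ i : Fin m, v i.castSucc < u i ∧ u i < v i.succ},
      (∏ j : Fin m, ∏ i ∈ Finset.Iio j, (u j - u i)) *
        ∏ i : Fin m, ∏ j : Fin (m + 1), |u i - v j| ^ (θ - 1))
    = Real.Gamma θ ^ (m + 1) / Real.Gamma (((m : ℝ) + 1) * θ) *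
        ∏ j : Fin (m + 1), ∏ i ∈ Finset.Iio j, (v j - v i) ^ (2 * θ - 1) := by
  have hVpos := prod_Iio_sub_pos hv
  have key := integral_image_eq_integral_abs_det_fderiv_smul volume (measurableSet_interlacing v)
    (fun u hu => (hasFDerivAt_residue hv hu).hasFDerivWithinAt) (injOn_residue hv)
    fun y => ((1 - ∑ i, y i) * ∏ i, y i) ^ (θ - 1)
  rw [image_residue hv, integral_openCornerSimplex m hθ] at key
  have hprod : ∏ j : Fin (m + 1), ∏ i ∈ Finset.Iio j, (v j - v i) ^ (2 * θ - 1) =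
      (∏ j : Fin (m + 1), ∏ i ∈ Finset.Iio j, (v j - v i)) ^ (2 * θ - 1) := by
    have hnonneg (j : Fin (m + 1)) (i) (hi : i ∈ Finset.Iio j) : 0 ≤ v j - v i :=
      (sub_pos.2 (hv (Finset.mem_Iio.1 hi))).le
    rw [← finsetProd_rpow _ _ fun j _ => Finset.prod_nonneg (hnonneg j)]
    exact Finset.prod_congr rfl fun j _ => finsetProd_rpow _ _ (hnonneg j) _
  rw [hprod, key, ← integral_mul_const]
  refine setIntegral_congr_fun (measurableSet_interlacing v) fun u hu => ?_
  have hpow : ∏ i : Fin m, ∏ j : Fin (m + 1), |u i - v j| ^ (θ - 1) =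
      (∏ i : Fin m, ∏ j : Fin (m + 1), |u i - v j|) ^ (θ - 1) := by
    rw [← finsetProd_rpow _ _ fun i _ => Finset.prod_nonneg fun j _ => abs_nonneg _]
    exact Finset.prod_congr rfl fun i _ => finsetProd_rpow _ _ (fun j _ => abs_nonneg _) _
  have hres : 0 < ∏ j, residue v u j := Finset.prod_pos fun j _ => residue_pos hv hu j
  simp only [smul_eq_mul]
  rw [hpow, ← prod_residue_mul hv hu, ← abs_det_fderiv_residue_mul hv hu,
    ← residue_zero hv.injective, ← Fin.prod_univ_succ (residue v u),
    mul_rpow hres.le (sq_nonneg _), ← rpow_natCast, ← rpow_mul hVpos.le,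
    show 2 * θ - 1 = 1 + ((2 : ℕ) : ℝ) * (θ - 1) by push_cast; ring, rpow_add hVpos, rpow_one]
  ring
end

section
/- Normalization of the Hermite β ensemble (Mehta-type Selberg integral): For every integer N ≥ 1 and reals θ > 0 and t > 0, the integral over the open Weyl chamber W^N = {y ∈ ℝ^N : y_1 < y_2 < ⋯ < y_N} of ∏_{1≤i<j≤N} (y_j − y_i)^{2θ} · ∏_{i=1}^N exp(−y_i²/(2t)) with respect to Lebesgue measure equals t^{θN(N−1)/2 + N/2} · (2π)^{N/2} · ∏_{j=1}^N Γ(jθ)/Γ(θ). -/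
open MeasureTheory Real

namespace HermiteBeta

open Finset Polynomial

variable {n : ℕ}

/-- The Vandermonde product `∏_{i<j} (y j - y i)`. -/
def vdm (y : Fin n → ℝ) : ℝ := ∏ j, ∏ i ∈ Iio j, (y j - y i)

/-- The derivative of `∏ k, (X - y k)` at the node `y j`. -/
def nodeDiff (y : Fin n → ℝ) (j : Fin n) : ℝ := ∏ k ∈ univ.erase j, (y j - y k)

/-- The sequences `x` and `y` interlace: `y 0 < x 0 < y 1 < ⋯ < x (n - 1) < y n`. -/
def Interlace (x : Fin n → ℝ) (y : Fin (n + 1) → ℝ) : Prop :=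
  ∀ i, y i.castSucc < x i ∧ x i < y i.succ

/-- The absolute value of the resultant of `∏ (X - x i)` and `∏ (X - y j)`. -/
def cross {m : ℕ} (x : Fin m → ℝ) (y : Fin n → ℝ) : ℝ := ∏ i, ∏ j, |x i - y j|

lemma cross_comm {m : ℕ} (x : Fin m → ℝ) (y : Fin n → ℝ) : cross x y = cross y x := by
  unfold cross
  rw [prod_comm]
  simp_rw [abs_sub_comm]

lemma prod_Ioi_comm (f : Fin n → Fin n → ℝ) :
    ∏ i, ∏ j ∈ Ioi i, f i j = ∏ j, ∏ i ∈ Iio j, f i j := by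
  apply prod_comm'
  simp

lemma abs_prod_nodeDiff (y : Fin n → ℝ) : ∏ j, |nodeDiff y j| = vdm y ^ 2 := by
  have h (j : Fin n) : |nodeDiff y j| =
      (∏ k ∈ Iio j, |y j - y k|) * ∏ k ∈ Ioi j, |y k - y j| := by
    rw [nodeDiff, abs_prod]
    have : univ.erase j = (Iio j).disjUnion (Ioi j)
        (disjoint_left.2 fun a => by simp; intro h; exact h.le) := by
      ext k; simp
    rw [this, prod_disjUnion]
    simp_rw [abs_sub_comm (y j)]
  simp_rw [h, prod_mul_distrib]
  rw [prod_Ioi_comm (fun i j => |y j - y i|), ← sq_abs, vdm, abs_prod]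
  simp_rw [abs_prod]
  ring

lemma nodeDiff_ne_zero {y : Fin n → ℝ} (hy : Function.Injective y) (j : Fin n) :
    nodeDiff y j ≠ 0 := by
  refine prod_ne_zero_iff.2 fun k hk => sub_ne_zero.2 fun h => ?_
  exact (mem_erase.1 hk).1 (hy h).symm

lemma vdm_pos {y : Fin n → ℝ} (hy : StrictMono y) : 0 < vdm y :=
  prod_pos fun _ _ => prod_pos fun _ hi => sub_pos.2 (hy (mem_Iio.1 hi))

/-- The bordered Cauchy matrix. -/
noncomputable def borderedCauchy (x : Fin n → ℝ) (y : Fin (n + 1) → ℝ) :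
    Matrix (Fin (n + 1)) (Fin (n + 1)) ℝ :=
  Matrix.of fun i j => (Fin.cons 1 (fun i => (x i - y j)⁻¹) : Fin (n + 1) → ℝ) i

lemma coeff_sum_eq_eval {p : ℝ[X]} (hp : p.natDegree < n) (z : ℝ) :
    ∑ k : Fin n, z ^ (k : ℕ) * p.coeff k = p.eval z := by
  rw [eval_eq_sum_range' hp, Fin.sum_univ_eq_sum_range (fun k => z ^ k * p.coeff k)]
  simp_rw [mul_comm]

lemma natDegree_prod_erase (y : Fin (n + 1) → ℝ) (j : Fin (n + 1)) :
    (∏ k ∈ univ.erase j, (X - C (y k))).natDegree = n := by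
  rw [natDegree_finsetProd_X_sub_C_eq_card]
  simp

lemma abs_det_borderedCauchy {x : Fin n → ℝ} {y : Fin (n + 1) → ℝ} (hy : StrictMono y)
    (hxy : ∀ i j, x i ≠ y j) :
    |(borderedCauchy x y).det| * cross x y = |vdm x| * vdm y := by
  let P : Fin (n + 1) → ℝ[X] := fun j => ∏ k ∈ univ.erase j, (X - C (y k))
  have hP (j) : (P j).natDegree < n + 1 := by
    simp only [P, natDegree_prod_erase]; omega
  have hev (j z) : (P j).eval z = ∏ k ∈ univ.erase j, (z - y k) := by
    simp [P, eval_prod]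
  let M : Matrix (Fin (n + 1)) (Fin (n + 1)) ℝ := Matrix.of fun k j => (P j).coeff k
  have h1 : Matrix.vandermonde y * M = Matrix.diagonal (nodeDiff y) := by
    ext i j
    simp only [Matrix.mul_apply, Matrix.vandermonde_apply, M, Matrix.of_apply]
    rw [coeff_sum_eq_eval (hP j), hev]
    by_cases h : i = j
    · subst h; simp [nodeDiff]
    · rw [Matrix.diagonal_apply_ne _ h]
      exact prod_eq_zero (mem_erase.2 ⟨h, mem_univ i⟩) (sub_self _)
  have hV : |(Matrix.vandermonde y).det| = vdm y := by
    rw [Matrix.det_vandermonde, prod_Ioi_comm (fun i j => y j - y i)]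
    exact abs_of_pos (vdm_pos hy)
  have hM : |M.det| = vdm y := by
    have := congrArg (fun A => |Matrix.det A|) h1
    simp only [Matrix.det_mul, abs_mul, hV, Matrix.det_diagonal, abs_prod,
      abs_prod_nodeDiff, sq] at this
    exact mul_left_cancel₀ (vdm_pos hy).ne' this
  let V := Matrix.projVandermonde (Fin.cons 1 x : Fin (n + 1) → ℝ) (Fin.cons 0 1)
  have hVx : |V.det| = |vdm x| := by
    have (i : Fin n) : Ioi i.succ = (Ioi i).map (Fin.succEmb n) := by
      ext j; refine Fin.cases ?_ (fun j => ?_) j <;> simp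
    simp only [V]
    rw [Matrix.det_projVandermonde, Fin.prod_univ_succ, vdm,
      ← prod_Ioi_comm (fun i j => x j - x i)]
    simp_rw [this]
    rw [Fin.Ioi_zero_eq_map]
    simp [abs_mul, abs_prod]
  have h2 : V * M = Matrix.diagonal (Fin.cons 1 fun i => ∏ j, (x i - y j)) *
      borderedCauchy x y := by
    ext i j
    rw [Matrix.diagonal_mul, Matrix.mul_apply]
    simp only [V, Matrix.projVandermonde_apply, M, Matrix.of_apply, borderedCauchy]
    refine Fin.cases ?_ (fun i => ?_) i
    · rw [Fintype.sum_eq_single (Fin.last n)]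
      · have := (monic_prod_of_monic (univ.erase j) (fun k => X - C (y k))
          fun k _ => monic_X_sub_C _).coeff_natDegree
        rw [natDegree_prod_erase] at this
        simp [P, this]
      · intro k hk
        have : n - k.1 ≠ 0 := by
          have := Fin.val_lt_last hk
          omega
        simp [this]
    · simp only [Fin.cons_succ, Pi.one_apply, one_pow, mul_one]
      rw [coeff_sum_eq_eval (hP j), hev, ← mul_prod_erase univ _ (mem_univ j)]
      have := sub_ne_zero.2 (hxy i j)
      field_simp
  have := congrArg (fun A => |Matrix.det A|) h2
  simp only [Matrix.det_mul, abs_mul, hM, hVx, Matrix.det_diagonal] at this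
  rw [this, Fin.prod_univ_succ, mul_comm]
  simp [cross, abs_prod]

lemma sign_prod_sub {ι : Type*} (s : Finset ι) (a : ℝ) (b : ι → ℝ) (h : ∀ i ∈ s, b i ≠ a) :
    0 < (-1) ^ #{i ∈ s | a < b i} * ∏ i ∈ s, (a - b i) := by
  have : (-1 : ℝ) ^ #{i ∈ s | a < b i} = ∏ i ∈ s, if a < b i then -1 else 1 := by
    rw [prod_ite, prod_const, prod_const_one, mul_one]
  rw [this, ← prod_mul_distrib]
  refine prod_pos fun i hi => ?_
  split_ifs with hab
  · linarith
  · have := lt_of_le_of_ne (not_lt.1 hab) (h i hi)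
    linarith

lemma neg_one_pow_eq_of_add {a b k : ℕ} (h : a + 2 * k = b) : (-1 : ℝ) ^ a = (-1) ^ b := by
  rw [← h, pow_add, pow_mul]
  simp

lemma sign_nodeDiff {y : Fin n → ℝ} (hy : StrictMono y) (j : Fin n) :
    0 < (-1) ^ (n + j + 1) * nodeDiff y j := by
  have h := sign_prod_sub (univ.erase j) (y j) y
    fun i hi h => (mem_erase.1 hi).1 (hy.injective h)
  have hc : ({i ∈ univ.erase j | y j < y i} : Finset _) = Ioi j := by
    ext i
    simp only [mem_filter, mem_erase, mem_univ, and_true, hy.lt_iff_lt, mem_Ioi]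
    exact ⟨fun h => h.2, fun h => ⟨h.ne', h⟩⟩
  rw [hc, Fin.card_Ioi, neg_one_pow_eq_of_add (b := n + j + 1) (k := j + 1) (by omega)] at h
  exact h

namespace Interlace

variable {x : Fin n → ℝ} {y : Fin (n + 1) → ℝ}

lemma strictMono_right (h : Interlace x y) : StrictMono y :=
  Fin.strictMono_iff_lt_succ.2 fun i => (h i).1.trans (h i).2

lemma strictMono_left (h : Interlace x y) : StrictMono x := fun i k hik =>
  (h i).2.trans_le <| (h.strictMono_right.monotone (Fin.succ_le_castSucc_iff.2 hik)).trans (h k).1.le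

lemma lt_iff (h : Interlace x y) (i : Fin n) (j : Fin (n + 1)) : x i < y j ↔ i.castSucc < j := by
  refine ⟨fun hlt => ?_, fun hlt => ?_⟩
  · by_contra! hle
    exact absurd (h.strictMono_right.monotone hle) (not_le.2 ((h i).1.trans hlt))
  · exact (h i).2.trans_le (h.strictMono_right.monotone (Fin.castSucc_lt_iff_succ_le.1 hlt))

lemma lt_iff' (h : Interlace x y) (i : Fin n) (j : Fin (n + 1)) : y j < x i ↔ j ≤ i.castSucc := by
  refine ⟨fun hlt => ?_, fun hle => ?_⟩
  · rw [← not_lt, ← h.lt_iff]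
    exact hlt.le.not_gt
  · exact (h.strictMono_right.monotone hle).trans_lt (h i).1

lemma ne (h : Interlace x y) (i : Fin n) (j : Fin (n + 1)) : x i ≠ y j := by
  rcases lt_or_ge i.castSucc j with hij | hij
  · exact ((h.lt_iff i j).2 hij).ne
  · exact ((h.lt_iff' i j).2 hij).ne'

lemma sign_left (h : Interlace x y) (i : Fin n) :
    0 < (-1) ^ (n + i : ℕ) * ∏ j, (x i - y j) := by
  have H := sign_prod_sub univ (x i) y fun j _ => (h.ne i j).symm
  have hc : ({j | x i < y j} : Finset _) = Ioi i.castSucc := by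
    ext j
    simp [h.lt_iff]
  rw [hc, Fin.card_Ioi, neg_one_pow_eq_of_add (b := n + i) (k := i)
    (by simp only [Fin.val_castSucc]; omega)] at H
  exact H

lemma sign_right (h : Interlace x y) (j : Fin (n + 1)) :
    0 < (-1) ^ (n + j : ℕ) * ∏ i, (y j - x i) := by
  have H := sign_prod_sub univ (y j) x fun i _ => h.ne i j
  have hc : #{i | y j < x i} = n - j := by
    rw [← card_map Fin.castSuccEmb]
    have : ({i | y j < x i} : Finset (Fin n)).map Fin.castSuccEmb = Ico j (Fin.last n) := by
      ext k
      refine Fin.lastCases ?_ (fun k => ?_) k <;> simp [h.lt_iff', Fin.castSucc_lt_last]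
    rw [this, Fin.card_Ico, Fin.val_last]
  rw [hc, neg_one_pow_eq_of_add (b := n + j) (k := j) (by omega)] at H
  exact H

end Interlace

lemma exists_roots {m : ℕ} (f : ℝ[X]) (l r : Fin m → ℝ) (hlr : ∀ i, l i < r i) (c : ℕ)
    (hl : ∀ i : Fin m, 0 < (-1) ^ (c + 1 + i : ℕ) * f.eval (l i))
    (hr : ∀ i : Fin m, 0 < (-1) ^ (c + i : ℕ) * f.eval (r i)) :
    ∃ y : Fin m → ℝ, ∀ i, l i < y i ∧ y i < r i ∧ f.eval (y i) = 0 := by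
  have (i : Fin m) : ∃ z, l i < z ∧ z < r i ∧ f.eval z = 0 := by
    have h1 := hl i
    have h2 := hr i
    have hc : ContinuousOn (fun z => f.eval z) (Set.Icc (l i) (r i)) := f.continuous.continuousOn
    rw [show c + 1 + (i : ℕ) = c + i + 1 by ring, pow_succ] at h1
    rcases neg_one_pow_eq_or ℝ (c + i) with h | h <;> rw [h] at h1 h2
    · obtain ⟨z, hz, hz'⟩ := intermediate_value_Ioo (hlr i).le hc
        (show (0 : ℝ) ∈ Set.Ioo _ _ from ⟨by linarith, by linarith⟩)
      exact ⟨z, hz.1, hz.2, hz'⟩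
    · obtain ⟨z, hz, hz'⟩ := intermediate_value_Ioo' (hlr i).le hc
        (show (0 : ℝ) ∈ Set.Ioo _ _ from ⟨by linarith, by linarith⟩)
      exact ⟨z, hz.1, hz.2, hz'⟩
  choose y hy using this
  exact ⟨y, hy⟩

lemma prod_X_sub_C_injOn {y y' : Fin n → ℝ} (hy : StrictMono y) (hy' : StrictMono y')
    (h : ∏ j, (X - C (y j)) = ∏ j, (X - C (y' j))) : y = y' := by
  refine (hy.range_inj hy').1 ?_
  ext z
  have := congrArg (fun p : ℝ[X] => p.eval z = 0) h
  simp only [eval_prod, eval_sub, eval_X, eval_C, prod_eq_zero_iff, mem_univ, true_and,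
    sub_eq_zero, eq_iff_iff] at this
  simpa [eq_comm] using this

lemma prod_X_sub_C_top_coeff (a : Fin n → ℝ) :
    ((∏ i, (X - C (a i))) * X ^ 2).coeff (n + 2) = 1 ∧
    ((∏ i, (X - C (a i))) * X ^ 2).coeff (n + 1) = -∑ i, a i ∧
    2 * ((∏ i, (X - C (a i))) * X ^ 2).coeff n = (∑ i, a i) ^ 2 - ∑ i, a i ^ 2 ∧
    ∀ k, n < k → ((∏ i, (X - C (a i))) * X ^ 2).coeff (k + 2) = 0 := by
  induction n with
  | zero => simp [coeff_X_pow]; intro k hk; omega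
  | succ n ih =>
    obtain ⟨h1, h2, h3, h4⟩ := ih fun i => a i.succ
    rw [Fin.prod_univ_succ, mul_assoc]
    set P := (∏ i : Fin n, (X - C (a i.succ))) * X ^ 2
    have hc (k : ℕ) : ((X - C (a 0)) * P).coeff (k + 1) = P.coeff k - a 0 * P.coeff (k + 1) := by
      rw [sub_mul, coeff_sub, coeff_X_mul, coeff_C_mul]
    refine ⟨?_, ?_, ?_, fun k hk => ?_⟩
    · rw [show n + 1 + 2 = n + 2 + 1 by ring, hc, h1, show n + 2 + 1 = n + 1 + 2 by ring,
        h4 _ (by omega)]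
      simp
    · rw [hc, h1, h2, Fin.sum_univ_succ]; ring
    · rw [hc, h2, mul_sub, h3, Fin.sum_univ_succ, Fin.sum_univ_succ]; ring
    · obtain ⟨k, rfl⟩ : ∃ l, k = l + 1 := ⟨k - 1, by omega⟩
      rw [show k + 1 + 2 = k + 2 + 1 by ring, hc, h4 k (by omega),
        show k + 2 + 1 = k + 1 + 2 by ring, h4 _ (by omega)]
      simp

/-- The polynomial `∑ i, w i ∏_{k ≠ i} (X - x k)`. -/
noncomputable def partialFrac (x w : Fin n → ℝ) : ℝ[X] :=
  ∑ i, C (w i) * ∏ k ∈ univ.erase i, (X - C (x k))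

lemma eval_partialFrac (x w : Fin n → ℝ) (i : Fin n) :
    (partialFrac x w).eval (x i) = w i * nodeDiff x i := by
  rw [partialFrac, eval_finsetSum, Fintype.sum_eq_single i]
  · simp [eval_prod, nodeDiff]
  · intro k hk
    rw [eval_mul, eval_prod, prod_eq_zero (mem_erase.2 ⟨hk.symm, mem_univ i⟩) (by simp), mul_zero]

lemma eval_partialFrac_of_ne (x w : Fin n → ℝ) (z : ℝ) (hz : ∀ i, z ≠ x i) :
    (partialFrac x w).eval z = (∏ i, (z - x i)) * ∑ i, w i / (z - x i) := by
  rw [partialFrac, eval_finsetSum, mul_sum]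
  refine sum_congr rfl fun i _ => ?_
  have := sub_ne_zero.2 (hz i)
  rw [← mul_prod_erase univ _ (mem_univ i)]
  simp only [eval_mul, eval_C, eval_prod, eval_sub, eval_X]
  field_simp

lemma coeff_partialFrac (x w : Fin n → ℝ) {k : ℕ} (hk : n ≤ k) :
    (partialFrac x w).coeff k = 0 := by
  rw [partialFrac, finsetSum_coeff]
  refine sum_eq_zero fun i _ => ?_
  obtain ⟨n, rfl⟩ : ∃ m, n = m + 1 := ⟨n - 1, by have := i.2; omega⟩
  rw [coeff_C_mul, coeff_eq_zero_of_natDegree_lt, mul_zero]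
  rw [natDegree_prod_erase]; omega

lemma coeff_partialFrac_self (x w : Fin (n + 1) → ℝ) :
    (partialFrac x w).coeff n = ∑ i, w i := by
  rw [partialFrac, finsetSum_coeff]
  refine sum_congr rfl fun i _ => ?_
  have := (monic_prod_of_monic (univ.erase i) (fun k => X - C (x k))
    fun k _ => monic_X_sub_C _).coeff_natDegree
  rw [natDegree_prod_erase] at this
  rw [coeff_C_mul, this, mul_one]

lemma coeff_partialFrac_mul_X_sq (x w : Fin n → ℝ) :
    (partialFrac x w * X ^ 2).coeff (n + 1) = ∑ i, w i := by
  cases n with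
  | zero => simp [partialFrac]
  | succ n => rw [show n + 1 + 1 = n + 2 by ring, coeff_mul_X_pow, coeff_partialFrac_self]

lemma eq_zero_of_coeff_of_eval {x : Fin n → ℝ} (hx : Function.Injective x) {p : ℝ[X]}
    (hp : ∀ k, n ≤ k → p.coeff k = 0) (h : ∀ i, p.eval (x i) = 0) : p = 0 := by
  refine eq_zero_of_degree_lt_of_eval_index_eq_zero (s := univ) hx.injOn ?_ fun i _ => h i
  rw [card_univ, Fintype.card_fin]
  exact (degree_lt_iff_coeff_zero _ _).2 hp

lemma coeff_prod_sub_prod (a b : Fin n → ℝ) {k : ℕ} (hk : n ≤ k) :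
    (∏ i, (X - C (a i)) - ∏ i, (X - C (b i))).coeff k = 0 := by
  rw [coeff_sub, ← coeff_mul_X_pow _ 2, ← coeff_mul_X_pow (∏ i, (X - C (b i))) 2]
  rcases hk.eq_or_lt with rfl | hk
  · rw [(prod_X_sub_C_top_coeff a).1, (prod_X_sub_C_top_coeff b).1, sub_self]
  · rw [(prod_X_sub_C_top_coeff a).2.2.2 k hk, (prod_X_sub_C_top_coeff b).2.2.2 k hk, sub_self]

lemma div_pos_of_sign {a b : ℝ} {k : ℕ} (ha : 0 < (-1) ^ k * a) (hb : 0 < (-1) ^ k * b) :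
    0 < a / b := by
  rw [← mul_div_mul_left a b (pow_ne_zero k (by norm_num : (-1 : ℝ) ≠ 0))]
  exact div_pos ha hb

/-- The map sending `y` to the constants `c`, `w i` in
`∏ (z - y j) / ∏ (z - x i) = z - c - ∑ w i / (z - x i)`. -/
noncomputable def gaussMap (x : Fin n → ℝ) (y : Fin (n + 1) → ℝ) : Fin (n + 1) → ℝ :=
  Fin.cons (∑ j, y j - ∑ i, x i) fun i => -(∏ j, (x i - y j)) / nodeDiff x i

@[simp] lemma gaussMap_zero (x : Fin n → ℝ) (y : Fin (n + 1) → ℝ) :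
    gaussMap x y 0 = ∑ j, y j - ∑ i, x i := rfl

@[simp] lemma gaussMap_succ (x : Fin n → ℝ) (y : Fin (n + 1) → ℝ) (i : Fin n) :
    gaussMap x y i.succ = -(∏ j, (x i - y j)) / nodeDiff x i := rfl

lemma prod_X_sub_C_eq_gaussMap {x : Fin n → ℝ} (hx : Function.Injective x)
    (y : Fin (n + 1) → ℝ) :
    ∏ j, (X - C (y j)) =
      ∏ j, (X - C ((Fin.cons (gaussMap x y 0) x : Fin (n + 1) → ℝ) j)) -
        partialFrac x fun i => gaussMap x y i.succ := by
  rw [eq_comm, ← sub_eq_zero]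
  set b : Fin (n + 1) → ℝ := Fin.cons (gaussMap x y 0) x
  refine eq_zero_of_coeff_of_eval hx (fun k hk => ?_) fun i => ?_
  · rw [sub_right_comm, coeff_sub, coeff_partialFrac _ _ hk, sub_zero]
    rcases hk.eq_or_lt with rfl | hk
    · rw [coeff_sub, ← coeff_mul_X_pow _ 2, ← coeff_mul_X_pow (∏ i, (X - C (y i))) 2,
        (prod_X_sub_C_top_coeff b).2.1, (prod_X_sub_C_top_coeff y).2.1, Fin.sum_univ_succ]
      simp [b]
    · exact coeff_prod_sub_prod _ _ hk
  · have h0 : (∏ j, (X - C (b j))).eval (x i) = 0 := by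
      rw [eval_prod]
      exact prod_eq_zero (mem_univ i.succ) (by simp [b])
    rw [eval_sub, eval_sub, h0, eval_partialFrac, gaussMap_succ,
      div_mul_cancel₀ _ (nodeDiff_ne_zero hx i)]
    simp [eval_prod]

lemma sum_sq_gaussMap {x : Fin n → ℝ} (hx : Function.Injective x) (y : Fin (n + 1) → ℝ) :
    ∑ j, y j ^ 2 = gaussMap x y 0 ^ 2 + ∑ i, x i ^ 2 + 2 * ∑ i : Fin n, gaussMap x y i.succ := by
  have h := congrArg (fun p : ℝ[X] => 2 * (p * X ^ 2).coeff (n + 1))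
    (prod_X_sub_C_eq_gaussMap hx y)
  simp only [sub_mul, coeff_sub, coeff_partialFrac_mul_X_sq, mul_sub] at h
  rw [(prod_X_sub_C_top_coeff _).2.2.1, (prod_X_sub_C_top_coeff _).2.2.1] at h
  have h0 : ∑ j, y j = gaussMap x y 0 + ∑ i, x i := by simp
  rw [Fin.sum_univ_succ (Fin.cons (gaussMap x y 0) x : Fin (n + 1) → ℝ),
    Fin.sum_univ_succ (fun i => (Fin.cons (gaussMap x y 0) x : Fin (n + 1) → ℝ) i ^ 2), h0] at h
  simp only [Fin.cons_zero, Fin.cons_succ] at h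
  linarith

lemma gaussMap_injOn {x : Fin n → ℝ} (hx : Function.Injective x) :
    Set.InjOn (gaussMap x) {y | Interlace x y} := by
  intro y hy y' hy' h
  refine prod_X_sub_C_injOn hy.strictMono_right hy'.strictMono_right ?_
  rw [prod_X_sub_C_eq_gaussMap hx y, prod_X_sub_C_eq_gaussMap hx y', h]

lemma gaussMap_succ_pos {x : Fin n → ℝ} {y : Fin (n + 1) → ℝ} (h : Interlace x y) (i : Fin n) :
    0 < gaussMap x y i.succ := by
  have h1 := h.sign_left i
  have h2 := sign_nodeDiff h.strictMono_left i
  rw [gaussMap_succ]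
  refine div_pos_of_sign (k := n + i + 1) ?_ h2
  rw [pow_succ]
  linarith

lemma cons_lt_snoc {x : Fin n → ℝ} (hx : StrictMono x) {L R : ℝ} (hLR : L < R)
    (hL : ∀ i, L < x i) (hR : ∀ i, x i < R) (j : Fin (n + 1)) :
    (Fin.cons L x : Fin (n + 1) → ℝ) j < (Fin.snoc x R : Fin (n + 1) → ℝ) j := by
  refine Fin.lastCases ?_ (fun i => ?_) j
  · rw [Fin.snoc_last]
    exact Fin.cases hLR (fun i => by simpa using hR i) (Fin.last n)
  · rw [Fin.snoc_castSucc]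
    have (k : Fin (n + 1)) : k ≤ i.castSucc → (Fin.cons L x : Fin (n + 1) → ℝ) k < x i := by
      refine Fin.cases (fun _ => hL i) (fun k hk => ?_) k
      exact hx (Fin.succ_le_castSucc_iff.1 hk)
    exact this _ le_rfl

lemma exists_interlace_gaussMap_eq {x : Fin n → ℝ} (hx : StrictMono x) {v : Fin (n + 1) → ℝ}
    (hv : ∀ i : Fin n, 0 < v i.succ) : ∃ y, Interlace x y ∧ gaussMap x y = v := by
  let w : Fin n → ℝ := fun i => v i.succ
  set b : Fin (n + 1) → ℝ := Fin.cons (v 0) x with hb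
  set Q : ℝ[X] := ∏ j, (X - C (b j)) - partialFrac x w with hQ
  have hQx (i : Fin n) : Q.eval (x i) = -(v i.succ * nodeDiff x i) := by
    have h0 : (∏ j, (X - C (b j))).eval (x i) = 0 := by
      rw [eval_prod]
      exact prod_eq_zero (mem_univ i.succ) (by simp [b])
    rw [hQ, eval_sub, h0, eval_partialFrac, zero_sub]
  have hQz (z : ℝ) (hz : ∀ i, z ≠ x i) : Q.eval z =
      (∏ i, (z - x i)) * (z - v 0 - ∑ i, w i / (z - x i)) := by
    rw [hQ, eval_sub, eval_partialFrac_of_ne _ _ _ hz, eval_prod, Fin.prod_univ_succ]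
    simp only [b, Fin.cons_zero, Fin.cons_succ, eval_sub, eval_X, eval_C]
    ring
  have hsx (i : Fin n) : 0 < (-1) ^ (n + i : ℕ) * Q.eval (x i) := by
    have := mul_pos (hv i) (sign_nodeDiff hx i)
    rw [hQx]
    rw [pow_succ] at this
    linarith
  obtain ⟨L, hL, hLx⟩ : ∃ L, L < v 0 - ∑ i, w i ∧ ∀ i, L < x i - 1 :=
    ((Filter.eventually_lt_atBot _).and
      (Filter.eventually_all.2 fun i => Filter.eventually_lt_atBot (x i - 1))).exists
  obtain ⟨R, hR, hRx⟩ : ∃ R, v 0 + ∑ i, w i < R ∧ ∀ i, x i + 1 < R :=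
    ((Filter.eventually_gt_atTop _).and
      (Filter.eventually_all.2 fun i => Filter.eventually_gt_atTop (x i + 1))).exists
  have hQL : 0 < (-1) ^ (n + 1) * Q.eval L := by
    rw [hQz L fun i => by linarith [hLx i]]
    have h1 := sign_prod_sub univ L x fun i _ => by linarith [hLx i]
    have h2 : ({i | L < x i} : Finset (Fin n)) = univ :=
      filter_true_of_mem fun i _ => by linarith [hLx i]
    rw [h2, card_univ, Fintype.card_fin] at h1
    have h3 : -∑ i, w i ≤ ∑ i, w i / (L - x i) := by
      rw [← sum_neg_distrib]
      refine sum_le_sum fun i _ => ?_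
      have h4 : 1 ≤ x i - L := by linarith [hLx i]
      rw [← neg_sub (x i) L, div_neg]
      exact neg_le_neg (div_le_self (hv i).le h4)
    have := mul_pos h1 (show 0 < -(L - v 0 - ∑ i, w i / (L - x i)) by linarith)
    rw [pow_succ]
    linarith
  have hQR : 0 < Q.eval R := by
    rw [hQz R fun i => by linarith [hRx i]]
    refine mul_pos (prod_pos fun i _ => by linarith [hRx i]) ?_
    have h3 : ∑ i, w i / (R - x i) ≤ ∑ i, w i := by
      refine sum_le_sum fun i _ => div_le_self (hv i).le (by linarith [hRx i])
    linarith
  obtain ⟨y, hy⟩ := exists_roots Q (Fin.cons L x : Fin (n + 1) → ℝ)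
    (Fin.snoc x R : Fin (n + 1) → ℝ) (cons_lt_snoc hx
      (by linarith [Finset.sum_nonneg fun i (_ : i ∈ univ) => (hv i).le])
      (fun i => by linarith [hLx i]) fun i => by linarith [hRx i])
    n (fun i => by
      refine Fin.cases ?_ (fun i => ?_) i
      · simpa using hQL
      · have := hsx i
        rw [neg_one_pow_eq_of_add (b := n + 1 + (i.succ : Fin (n + 1)).val) (k := 1)
          (by simp only [Fin.val_succ]; omega)] at this
        simpa using this)
    (fun i => by
      refine Fin.lastCases ?_ (fun i => ?_) i
      · simpa [← two_mul, pow_mul] using hQR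
      · simpa using hsx i)
  have hI : Interlace x y := fun i => by
    have h1 := (hy i.castSucc).2.1
    have h2 := (hy i.succ).1
    rw [Fin.snoc_castSucc] at h1
    rw [Fin.cons_succ] at h2
    exact ⟨h1, h2⟩
  have hprod : ∏ j, (X - C (y j)) = Q := by
    rw [← sub_eq_zero]
    refine eq_zero_of_coeff_of_eval hI.strictMono_right.injective (fun k hk => ?_) fun j => ?_
    · rw [hQ, ← sub_add, coeff_add, coeff_prod_sub_prod _ _ hk,
        coeff_partialFrac _ _ (by omega), add_zero]
    · rw [eval_sub, (hy j).2.2, eval_prod, prod_eq_zero (mem_univ j) (by simp), sub_zero]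
  refine ⟨y, hI, funext fun j => ?_⟩
  refine Fin.cases ?_ (fun i => ?_) j
  · have h := congrArg (fun p : ℝ[X] => (p * X ^ 2).coeff (n + 2)) hprod
    simp only [hQ, sub_mul, coeff_sub] at h
    rw [(prod_X_sub_C_top_coeff y).2.1, (prod_X_sub_C_top_coeff b).2.1, coeff_mul_X_pow,
      coeff_partialFrac _ _ le_rfl, Fin.sum_univ_succ b] at h
    simp only [b, Fin.cons_zero, Fin.cons_succ] at h
    rw [gaussMap_zero]
    linarith
  · have h := congrArg (fun p : ℝ[X] => p.eval (x i)) hprod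
    simp only [hQx, eval_prod, eval_sub, eval_X, eval_C] at h
    rw [gaussMap_succ, h, neg_neg, mul_div_cancel_right₀ _ (nodeDiff_ne_zero hx.injective i)]

lemma gaussMap_image {x : Fin n → ℝ} (hx : StrictMono x) :
    gaussMap x '' {y | Interlace x y} = {v | ∀ i : Fin n, 0 < v i.succ} := by
  ext v
  constructor
  · rintro ⟨y, hy, rfl⟩ i
    exact gaussMap_succ_pos hy i
  · exact fun hv => exists_interlace_gaussMap_eq hx hv

/-- The map sending `(s, x)` to the constants `w j` in
`s ∏ (z - x i) / ∏ (z - y j) = ∑ w j / (z - y j)`. -/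
noncomputable def dixonMap (y u : Fin (n + 1) → ℝ) : Fin (n + 1) → ℝ :=
  fun j => u 0 * (∏ i : Fin n, (y j - u i.succ)) / nodeDiff y j

lemma partialFrac_dixonMap {y : Fin (n + 1) → ℝ} (hy : Function.Injective y)
    (u : Fin (n + 1) → ℝ) :
    partialFrac y (dixonMap y u) = C (u 0) * ∏ i : Fin n, (X - C (u i.succ)) := by
  rw [← sub_eq_zero]
  refine eq_zero_of_coeff_of_eval hy (fun k hk => ?_) fun j => ?_
  · rw [coeff_sub, coeff_partialFrac _ _ hk, coeff_C_mul, ← coeff_mul_X_pow _ 2,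
      (prod_X_sub_C_top_coeff _).2.2.2 k hk]
    simp
  · rw [eval_sub, eval_partialFrac, dixonMap, div_mul_cancel₀ _ (nodeDiff_ne_zero hy j)]
    simp [eval_prod]

lemma sum_dixonMap {y : Fin (n + 1) → ℝ} (hy : Function.Injective y) (u : Fin (n + 1) → ℝ) :
    ∑ j, dixonMap y u j = u 0 := by
  rw [← coeff_partialFrac_self y, partialFrac_dixonMap hy, coeff_C_mul, ← coeff_mul_X_pow _ 2,
    (prod_X_sub_C_top_coeff _).1, mul_one]

lemma dixonMap_pos {y u : Fin (n + 1) → ℝ} (h0 : 0 < u 0)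
    (h : Interlace (fun i => u i.succ) y) (j : Fin (n + 1)) : 0 < dixonMap y u j := by
  rw [dixonMap, mul_div_assoc]
  refine mul_pos h0 (div_pos_of_sign (h.sign_right j) ?_)
  have := sign_nodeDiff h.strictMono_right j
  rwa [← neg_one_pow_eq_of_add (a := n + j) (k := 1) (by omega)] at this

lemma dixonMap_injOn (y : Fin (n + 1) → ℝ) :
    Set.InjOn (dixonMap y) {u | 0 < u 0 ∧ Interlace (fun i => u i.succ) y} := by
  rintro u ⟨h0, hu⟩ u' ⟨h0', hu'⟩ h
  have hy := hu.strictMono_right.injective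
  have h1 : u 0 = u' 0 := by rw [← sum_dixonMap hy u, h, sum_dixonMap hy]
  have h2 := partialFrac_dixonMap hy u
  rw [h, partialFrac_dixonMap hy, ← h1] at h2
  have h3 := prod_X_sub_C_injOn hu'.strictMono_left hu.strictMono_left
    (mul_left_cancel₀ (C_ne_zero.2 h0.ne') h2)
  funext j
  exact Fin.cases h1 (fun i => (congrFun h3 i).symm) j

lemma exists_interlace_dixonMap_eq {y : Fin (n + 1) → ℝ} (hy : StrictMono y)
    {w : Fin (n + 1) → ℝ} (hw : ∀ j, 0 < w j) :
    ∃ u, (0 < u 0 ∧ Interlace (fun i => u i.succ) y) ∧ dixonMap y u = w := by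
  have hs (j : Fin (n + 1)) : 0 < (-1) ^ (n + j : ℕ) * (partialFrac y w).eval (y j) := by
    have := mul_pos (hw j) (sign_nodeDiff hy j)
    rw [← neg_one_pow_eq_of_add (a := n + j) (k := 1) (by omega)] at this
    rw [eval_partialFrac]
    linarith
  obtain ⟨x, hx⟩ := exists_roots (partialFrac y w) (fun i : Fin n => y i.castSucc)
    (fun i => y i.succ) (fun i => hy Fin.castSucc_lt_succ) (n + 1)
    (fun i => by
      have := hs i.castSucc
      rwa [neg_one_pow_eq_of_add (b := n + 1 + 1 + i) (k := 1)
        (by simp only [Fin.val_castSucc]; omega)] at this)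
    (fun i => by
      have := hs i.succ
      rwa [neg_one_pow_eq_of_add (b := n + 1 + i) (k := 0)
        (by simp only [Fin.val_succ]; omega)] at this)
  have hI : Interlace x y := fun i => ⟨(hx i).1, (hx i).2.1⟩
  have hpoly : partialFrac y w = C (∑ j, w j) * ∏ i, (X - C (x i)) := by
    rw [← sub_eq_zero]
    refine eq_zero_of_coeff_of_eval hI.strictMono_left.injective (fun k hk => ?_) fun i => ?_
    · rw [coeff_sub, coeff_C_mul, ← coeff_mul_X_pow (∏ i, (X - C (x i))) 2 k]
      rcases hk.eq_or_lt with rfl | hk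
      · rw [coeff_partialFrac_self, (prod_X_sub_C_top_coeff x).1, mul_one, sub_self]
      · rw [coeff_partialFrac _ _ hk, (prod_X_sub_C_top_coeff x).2.2.2 k hk, mul_zero, sub_self]
    · rw [eval_sub, (hx i).2.2, eval_mul, eval_prod, prod_eq_zero (mem_univ i) (by simp)]
      simp
  refine ⟨Fin.cons (∑ j, w j) x, ⟨?_, ?_⟩, funext fun j => ?_⟩
  · exact sum_pos (fun j _ => hw j) univ_nonempty
  · simpa using hI
  · have := congrArg (fun p : ℝ[X] => p.eval (y j)) hpoly
    simp only [eval_partialFrac, eval_mul, eval_C, eval_prod, eval_sub, eval_X] at this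
    simp only [dixonMap, Fin.cons_zero, Fin.cons_succ]
    rw [← this, mul_div_cancel_right₀ _ (nodeDiff_ne_zero hy.injective j)]

lemma dixonMap_image {y : Fin (n + 1) → ℝ} (hy : StrictMono y) :
    dixonMap y '' {u | 0 < u 0 ∧ Interlace (fun i => u i.succ) y} = {w | ∀ j, 0 < w j} := by
  ext w
  constructor
  · rintro ⟨u, hu, rfl⟩ j
    exact dixonMap_pos hu.1 hu.2 j
  · exact fun hw => exists_interlace_dixonMap_eq hy hw

section Calculus

open Matrix

lemma hasFDerivAt_prod_sub {m : ℕ} (a : ℝ) (y : Fin m → ℝ) (h : ∀ j, a ≠ y j) :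
    HasFDerivAt (fun y : Fin m → ℝ => ∏ j, (a - y j))
      (-(∏ j, (a - y j)) • ∑ j, (a - y j)⁻¹ • ContinuousLinearMap.proj (R := ℝ) j) y := by
  have := HasFDerivAt.finsetProd (u := univ) (x := y) (g := fun j (y : Fin m → ℝ) => a - y j)
    fun j _ => (hasFDerivAt_apply (𝕜 := ℝ) j y).const_sub a
  refine this.congr_fderiv ?_ |>.congr_of_eventuallyEq (.of_forall fun y => by simp)
  rw [smul_sum]
  refine sum_congr rfl fun j _ => ?_
  rw [← mul_prod_erase univ _ (mem_univ j), smul_smul, smul_neg, ← neg_smul]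
  congr 1
  have := sub_ne_zero.2 (h j)
  field_simp

lemma hasFDerivAt_gaussMap {x : Fin n → ℝ} {y : Fin (n + 1) → ℝ} (hxy : ∀ i j, x i ≠ y j) :
    HasFDerivAt (gaussMap x) (toLin' (diagonal (Fin.cons 1 fun i => -gaussMap x y i.succ) *
      borderedCauchy x y)).toContinuousLinearMap y := by
  rw [hasFDerivAt_pi']
  intro j
  refine Fin.cases ?_ (fun i => ?_) j
  · refine ((HasFDerivAt.fun_sum fun j _ => hasFDerivAt_apply (𝕜 := ℝ) j y).sub_const
      (∑ i, x i)).congr_fderiv ?_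
    ext v
    simp [toLin'_apply, mulVec, dotProduct, diagonal_mul, borderedCauchy]
  · refine (((hasFDerivAt_prod_sub (x i) y (hxy i)).neg).mul_const
      (nodeDiff x i)⁻¹).congr_fderiv ?_
    ext v
    simp only [toLin'_apply, mulVec, dotProduct, diagonal_mul, borderedCauchy, of_apply,
      Fin.cons_succ, ContinuousLinearMap.comp_apply, ContinuousLinearMap.proj_apply,
      LinearMap.coe_toContinuousLinearMap', _root_.smul_apply,
      _root_.neg_apply, _root_.sum_apply, smul_eq_mul, gaussMap_succ,
      mul_assoc, ← mul_sum]
    ring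

lemma hasFDerivAt_dixonMap {y u : Fin (n + 1) → ℝ} (h0 : u 0 ≠ 0)
    (hxy : ∀ (i : Fin n) j, u i.succ ≠ y j) :
    HasFDerivAt (dixonMap y) (toLin' (diagonal (dixonMap y u) *
      (borderedCauchy (fun i => u i.succ) y)ᵀ *
        diagonal (Fin.cons (u 0)⁻¹ 1))).toContinuousLinearMap u := by
  rw [hasFDerivAt_pi']
  intro j
  have hp : HasFDerivAt (fun u : Fin (n + 1) → ℝ => fun i : Fin n => u i.succ)
      (ContinuousLinearMap.pi fun i => ContinuousLinearMap.proj (R := ℝ) i.succ) u :=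
    (ContinuousLinearMap.pi fun i : Fin n =>
      ContinuousLinearMap.proj (R := ℝ) (φ := fun _ => ℝ) i.succ).hasFDerivAt
  have h1 := (hasFDerivAt_prod_sub (y j) (fun i : Fin n => u i.succ)
    fun i => (hxy i j).symm).comp u hp
  refine (((hasFDerivAt_apply (𝕜 := ℝ) 0 u).mul h1).mul_const
      (nodeDiff y j)⁻¹).congr_fderiv ?_
  ext v
  have h2 (i : Fin n) : (u i.succ - y j)⁻¹ = -(y j - u i.succ)⁻¹ := by
    rw [← inv_neg, neg_sub]
  simp only [toLin'_apply, mulVec, dotProduct, diagonal_mul, mul_diagonal, borderedCauchy,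
      of_apply, transpose_apply, ContinuousLinearMap.comp_apply, ContinuousLinearMap.proj_apply,
      LinearMap.coe_toContinuousLinearMap', _root_.smul_apply,
      _root_.add_apply, ContinuousLinearMap.pi_apply,
      _root_.sum_apply, smul_eq_mul, dixonMap,
      Function.comp_apply, Fin.sum_univ_succ, Fin.cons_succ, Fin.cons_zero, mul_assoc, ← mul_sum,
      Pi.one_apply, h2]
  simp only [one_mul, neg_mul, sum_neg_distrib]
  field_simp
  ring

lemma Interlace.cross_pos {x : Fin n → ℝ} {y : Fin (n + 1) → ℝ} (h : Interlace x y) :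
    0 < cross x y :=
  prod_pos fun i _ => prod_pos fun j _ => abs_pos.2 (sub_ne_zero.2 (h.ne i j))

lemma prod_gaussMap_succ {x : Fin n → ℝ} {y : Fin (n + 1) → ℝ} (h : Interlace x y) :
    ∏ i : Fin n, gaussMap x y i.succ = cross x y / vdm x ^ 2 := by
  rw [← abs_of_pos (prod_pos fun i _ => gaussMap_succ_pos h i), abs_prod, ← abs_prod_nodeDiff,
    cross, ← prod_div_distrib]
  simp [abs_div, abs_prod]

lemma prod_dixonMap {y u : Fin (n + 1) → ℝ} (h0 : 0 < u 0)
    (h : Interlace (fun i => u i.succ) y) :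
    ∏ j, dixonMap y u j = u 0 ^ (n + 1) * cross (fun i : Fin n => u i.succ) y / vdm y ^ 2 := by
  rw [← abs_of_pos (prod_pos fun j _ => dixonMap_pos h0 h j), abs_prod, ← abs_prod_nodeDiff,
    cross_comm, cross]
  simp [dixonMap, abs_div, abs_mul, abs_prod, abs_of_pos h0, prod_div_distrib, prod_mul_distrib]

lemma abs_det_gaussMap {x : Fin n → ℝ} {y : Fin (n + 1) → ℝ} (h : Interlace x y) :
    |(toLin' (diagonal (Fin.cons 1 fun i => -gaussMap x y i.succ) *
      borderedCauchy x y)).toContinuousLinearMap.det| = vdm y / vdm x := by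
  have hB := abs_det_borderedCauchy h.strictMono_right h.ne
  have hx := vdm_pos h.strictMono_left
  have hw : |∏ i : Fin n, -gaussMap x y i.succ| = cross x y / vdm x ^ 2 := by
    rw [← prod_gaussMap_succ h, abs_prod]
    exact prod_congr rfl fun i _ => by rw [abs_neg, abs_of_pos (gaussMap_succ_pos h i)]
  rw [LinearMap.det_toContinuousLinearMap, LinearMap.det_toLin', det_mul, det_diagonal,
    Fin.prod_univ_succ]
  simp only [Fin.cons_zero, Fin.cons_succ, one_mul]
  rw [abs_mul, hw, div_mul_eq_mul_div, mul_comm, hB, abs_of_pos hx]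
  field_simp

lemma abs_det_dixonMap {y u : Fin (n + 1) → ℝ} (h0 : 0 < u 0)
    (h : Interlace (fun i => u i.succ) y) :
    |(toLin' (diagonal (dixonMap y u) * (borderedCauchy (fun i => u i.succ) y)ᵀ *
        diagonal (Fin.cons (u 0)⁻¹ 1))).toContinuousLinearMap.det| =
      u 0 ^ n * vdm (fun i : Fin n => u i.succ) / vdm y := by
  have hB := abs_det_borderedCauchy h.strictMono_right h.ne
  have hx := vdm_pos h.strictMono_left
  have hy := vdm_pos h.strictMono_right
  rw [LinearMap.det_toContinuousLinearMap, LinearMap.det_toLin', det_mul, det_mul, det_diagonal,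
    det_diagonal, det_transpose, prod_dixonMap h0 h, Fin.prod_univ_succ]
  simp only [Fin.cons_zero, Fin.cons_succ, Pi.one_apply, prod_const_one, mul_one]
  rw [abs_mul, abs_mul, abs_of_pos (inv_pos.2 h0),
    abs_of_pos (div_pos (mul_pos (pow_pos h0 _) h.cross_pos) (pow_pos hy 2))]
  rw [abs_of_pos hx] at hB
  rw [mul_div_right_comm, mul_assoc _ (cross _ _), mul_comm (cross _ _), hB]
  field_simp
  ring

end Calculus

section Integration

open ENNReal

lemma lintegral_fin_succ_mul {f : ℝ → ℝ≥0∞} {g : (Fin n → ℝ) → ℝ≥0∞} (hf : Measurable f)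
    (hg : Measurable g) :
    ∫⁻ u : Fin (n + 1) → ℝ, f (u 0) * g (fun i => u i.succ) = (∫⁻ a, f a) * ∫⁻ x, g x := by
  rw [← lintegral_prod_mul hf.aemeasurable hg.aemeasurable]
  exact (volume_preserving_piFinSuccAbove (fun _ : Fin (n + 1) => ℝ) 0).lintegral_comp
    (f := fun p => f p.1 * g p.2) (by fun_prop)

lemma lintegral_fin_prod {f : ℝ → ℝ≥0∞} (hf : Measurable f) :
    ∫⁻ u : Fin n → ℝ, ∏ i, f (u i) = (∫⁻ a, f a) ^ n := by
  induction n with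
  | zero => simp [volume_pi]
  | succ n ih =>
    simp_rw [Fin.prod_univ_succ]
    rw [lintegral_fin_succ_mul (g := fun x => ∏ i, f (x i)) hf (by fun_prop), ih, pow_succ']

/-- The unnormalized Gamma density with shape `θ` and scale `t`. -/
noncomputable def gammaDensity (θ t : ℝ) : ℝ → ℝ≥0∞ :=
  (Set.Ioi 0).indicator fun w => ENNReal.ofReal (w ^ (θ - 1) * exp (-(t⁻¹ * w)))

lemma measurable_gammaDensity (θ t : ℝ) : Measurable (gammaDensity θ t) :=
  Measurable.indicator (by fun_prop) measurableSet_Ioi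

lemma gammaDensity_of_pos (θ t : ℝ) {w : ℝ} (hw : 0 < w) :
    gammaDensity θ t w = ENNReal.ofReal (w ^ (θ - 1) * exp (-(t⁻¹ * w))) :=
  Set.indicator_of_mem (Set.mem_Ioi.2 hw) _

lemma gammaDensity_of_nonpos (θ t : ℝ) {w : ℝ} (hw : ¬ 0 < w) : gammaDensity θ t w = 0 :=
  Set.indicator_of_notMem hw _

lemma lintegral_gammaDensity {θ t : ℝ} (hθ : 0 < θ) (ht : 0 < t) :
    ∫⁻ w, gammaDensity θ t w = ENNReal.ofReal (t ^ θ * Gamma θ) := by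
  have h := integral_rpow_mul_exp_neg_mul_Ioi hθ (inv_pos.2 ht)
  rw [one_div, inv_inv] at h
  have hpos : 0 < t ^ θ * Gamma θ := mul_pos (rpow_pos_of_pos ht _) (Gamma_pos_of_pos hθ)
  rw [gammaDensity, lintegral_indicator measurableSet_Ioi, ← h,
    ofReal_integral_eq_lintegral_ofReal]
  · exact Integrable.of_integral_ne_zero (h ▸ hpos.ne')
  · filter_upwards [ae_restrict_mem measurableSet_Ioi] with w hw
    exact mul_nonneg (rpow_nonneg (Set.mem_Ioi.1 hw).le _) (exp_pos _).le

lemma lintegral_gaussian {t : ℝ} (ht : 0 < t) :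
    ∫⁻ c : ℝ, ENNReal.ofReal (exp (-c ^ 2 / (2 * t))) = ENNReal.ofReal (√(2 * π * t)) := by
  have h := integral_gaussian (2 * t)⁻¹
  have he (c : ℝ) : -c ^ 2 / (2 * t) = -(2 * t)⁻¹ * c ^ 2 := by ring
  simp_rw [he]
  rw [← ofReal_integral_eq_lintegral_ofReal, h]
  · congr 2; field_simp
  · exact integrable_exp_neg_mul_sq (by positivity)
  · exact .of_forall fun c => (exp_pos _).le

lemma measurableSet_interlace :
    MeasurableSet {p : (Fin n → ℝ) × (Fin (n + 1) → ℝ) | Interlace p.1 p.2} := by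
  simp only [Interlace, Set.ofPred_forall]
  refine .iInter fun i => ?_
  have h1 : MeasurableSet {p : (Fin n → ℝ) × (Fin (n + 1) → ℝ) | p.2 i.castSucc < p.1 i} :=
    measurableSet_lt (by fun_prop) (by fun_prop)
  have h2 : MeasurableSet {p : (Fin n → ℝ) × (Fin (n + 1) → ℝ) | p.1 i < p.2 i.succ} :=
    measurableSet_lt (by fun_prop) (by fun_prop)
  exact h1.inter h2

lemma measurableSet_interlace_right (x : Fin n → ℝ) :
    MeasurableSet {y : Fin (n + 1) → ℝ | Interlace x y} :=
  measurable_prodMk_left measurableSet_interlace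

lemma measurableSet_interlace_left (y : Fin (n + 1) → ℝ) :
    MeasurableSet {x : Fin n → ℝ | Interlace x y} :=
  measurable_prodMk_right measurableSet_interlace

lemma setLIntegral_eq_of_forall_notMem {α : Type*} [MeasurableSpace α] {μ : Measure α} {s : Set α}
    (hs : MeasurableSet s) {f : α → ℝ≥0∞} (hf : ∀ a, a ∉ s → f a = 0) :
    ∫⁻ a in s, f a ∂μ = ∫⁻ a, f a ∂μ := by
  rw [← lintegral_indicator hs, Set.indicator_eq_self.2]
  exact fun a ha => by_contra fun h => ha (hf a h)

/-- The Gaussian weight. -/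
noncomputable def gaussWeight (t : ℝ) (y : Fin n → ℝ) : ℝ := ∏ i, exp (-(y i) ^ 2 / (2 * t))

lemma gaussWeight_pos (t : ℝ) (y : Fin n → ℝ) : 0 < gaussWeight t y :=
  prod_pos fun _ _ => exp_pos _

lemma gaussWeight_eq (t : ℝ) (y : Fin n → ℝ) :
    gaussWeight t y = exp (-(∑ i, y i ^ 2) / (2 * t)) := by
  rw [gaussWeight, ← exp_sum, ← sum_div, sum_neg_distrib]

lemma gaussWeight_eq_gaussMap {x : Fin n → ℝ} (hx : Function.Injective x) {t : ℝ} (ht : 0 < t)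
    (y : Fin (n + 1) → ℝ) :
    gaussWeight t y = gaussWeight t x * (exp (-(gaussMap x y 0) ^ 2 / (2 * t)) *
      ∏ i : Fin n, exp (-(t⁻¹ * gaussMap x y i.succ))) := by
  rw [gaussWeight_eq, gaussWeight_eq, sum_sq_gaussMap hx, ← exp_sum, ← exp_add, ← exp_add,
    sum_neg_distrib, ← mul_sum]
  congr 1
  field_simp
  ring

lemma rpow_two_mul_sub_one {a θ : ℝ} (ha : 0 < a) :
    a ^ (2 * θ - 1) = a * (a ^ 2) ^ (θ - 1) := by
  rw [show 2 * θ - 1 = 1 + 2 * (θ - 1) by ring, Real.rpow_add ha, Real.rpow_one,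
    Real.rpow_mul ha.le, Real.rpow_two]

lemma lintegral_interlace_right {x : Fin n → ℝ} (hx : StrictMono x) {θ t : ℝ} (hθ : 0 < θ)
    (ht : 0 < t) :
    ∫⁻ y in {y | Interlace x y},
        ENNReal.ofReal (vdm y * cross x y ^ (θ - 1) * gaussWeight t y) =
      ENNReal.ofReal (vdm x ^ (2 * θ - 1) * gaussWeight t x) *
        (ENNReal.ofReal √(2 * π * t) * ENNReal.ofReal (t ^ θ * Gamma θ) ^ n) := by
  let g : (Fin (n + 1) → ℝ) → ℝ≥0∞ := fun v =>
    ENNReal.ofReal (exp (-(v 0) ^ 2 / (2 * t))) * ∏ i : Fin n, gammaDensity θ t (v i.succ)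
  have hm := measurable_gammaDensity θ t
  have hg : ∫⁻ v, g v =
      ENNReal.ofReal √(2 * π * t) * ENNReal.ofReal (t ^ θ * Gamma θ) ^ n := by
    rw [← lintegral_gaussian ht, ← lintegral_gammaDensity hθ ht, ← lintegral_fin_prod hm]
    exact lintegral_fin_succ_mul (f := fun c => ENNReal.ofReal (exp (-c ^ 2 / (2 * t))))
      (g := fun x => ∏ i, gammaDensity θ t (x i)) (by fun_prop) (by fun_prop)
  have hS : MeasurableSet {v : Fin (n + 1) → ℝ | ∀ i : Fin n, 0 < v i.succ} := by
    simp only [Set.ofPred_forall]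
    exact .iInter fun i => measurableSet_lt (by fun_prop) (by fun_prop)
  have hg0 (v) (hv : v ∉ {v : Fin (n + 1) → ℝ | ∀ i : Fin n, 0 < v i.succ}) : g v = 0 := by
    simp only [Set.mem_ofPred_eq, not_forall] at hv
    obtain ⟨i, hi⟩ := hv
    simp only [g]
    rw [prod_eq_zero (mem_univ i) (gammaDensity_of_nonpos θ t hi), mul_zero]
  rw [← hg, ← setLIntegral_eq_of_forall_notMem hS (f := g) hg0, ← gaussMap_image hx,
    lintegral_image_eq_lintegral_abs_det_fderiv_mul volume (measurableSet_interlace_right x)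
      (fun y hy => (hasFDerivAt_gaussMap hy.ne).hasFDerivWithinAt) (gaussMap_injOn hx.injective),
    ← lintegral_const_mul' _ _ ofReal_ne_top]
  · refine setLIntegral_congr_fun (measurableSet_interlace_right x) fun y hy => ?_
    have hy : Interlace x y := hy
    have hpos := gaussMap_succ_pos hy
    have hvx := vdm_pos hx
    have hvy := vdm_pos hy.strictMono_right
    simp only [g, gammaDensity_of_pos θ t (hpos _)]
    rw [abs_det_gaussMap hy, ← ofReal_prod_of_nonneg (fun i _ => by have := hpos i; positivity),
      ← ofReal_mul (exp_pos _).le, ← ofReal_mul (by positivity),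
      ← ofReal_mul (mul_nonneg (by positivity) (gaussWeight_pos t x).le)]
    congr 1
    rw [prod_mul_distrib, finsetProd_rpow _ _ fun i _ => (hpos i).le, prod_gaussMap_succ hy,
      div_rpow hy.cross_pos.le (by positivity), rpow_two_mul_sub_one hvx,
      gaussWeight_eq_gaussMap hx.injective ht y]
    have : 0 < (vdm x ^ 2) ^ (θ - 1) := by positivity
    field_simp

/-- The **Dixon–Anderson integral** with equal exponents. -/
lemma lintegral_interlace_left {y : Fin (n + 1) → ℝ} (hy : StrictMono y) {θ : ℝ} (hθ : 0 < θ) :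
    ENNReal.ofReal (Gamma ((n + 1) * θ)) * ∫⁻ x in {x | Interlace x y},
        ENNReal.ofReal (vdm x * cross x y ^ (θ - 1)) =
      ENNReal.ofReal (vdm y ^ (2 * θ - 1)) * ENNReal.ofReal (Gamma θ) ^ (n + 1) := by
  have hm := measurable_gammaDensity θ 1
  have hS : MeasurableSet {w : Fin (n + 1) → ℝ | ∀ j, 0 < w j} := by
    simp only [Set.ofPred_forall]
    exact .iInter fun i => measurableSet_lt (by fun_prop) (by fun_prop)
  have hT : MeasurableSet {u : Fin (n + 1) → ℝ | 0 < u 0 ∧ Interlace (fun i => u i.succ) y} := by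
    have h1 : MeasurableSet {u : Fin (n + 1) → ℝ | 0 < u 0} :=
      measurableSet_lt (by fun_prop) (by fun_prop)
    exact h1.inter (measurableSet_preimage (f := fun (u : Fin (n + 1) → ℝ) (i : Fin n) => u i.succ)
      (by fun_prop) (measurableSet_interlace_left y))
  have hvy := vdm_pos hy
  have hn : (0 : ℝ) < (n + 1) * θ := by positivity
  have h1 : ENNReal.ofReal (Gamma θ) = ∫⁻ w, gammaDensity θ 1 w := by
    rw [lintegral_gammaDensity hθ one_pos]; simp
  have h2 : ENNReal.ofReal (Gamma ((n + 1) * θ)) = ∫⁻ w, gammaDensity ((n + 1) * θ) 1 w := by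
    rw [lintegral_gammaDensity hn one_pos]; simp
  rw [h1, h2, ← lintegral_fin_prod hm, ← setLIntegral_eq_of_forall_notMem hS,
    ← dixonMap_image hy,
    lintegral_image_eq_lintegral_abs_det_fderiv_mul _ hT
      (fun u hu => (hasFDerivAt_dixonMap hu.1.ne' hu.2.ne).hasFDerivWithinAt) (dixonMap_injOn y),
    ← lintegral_const_mul' _ _ ofReal_ne_top,
    ← lintegral_indicator (measurableSet_interlace_left y), ← lintegral_fin_succ_mul
      (measurable_gammaDensity _ _)
      (Measurable.indicator (by unfold vdm cross; fun_prop) (measurableSet_interlace_left y)),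
    ← lintegral_indicator hT]
  · refine lintegral_congr fun u => ?_
    by_cases hu : 0 < u 0 ∧ Interlace (fun i => u i.succ) y
    · obtain ⟨h0, hI⟩ := hu
      have hpos := dixonMap_pos h0 hI
      have hvx := vdm_pos hI.strictMono_left
      have hc := hI.cross_pos
      rw [Set.indicator_of_mem (by exact hI), Set.indicator_of_mem (by exact ⟨h0, hI⟩),
        gammaDensity_of_pos _ _ h0, abs_det_dixonMap h0 hI]
      simp only [gammaDensity_of_pos θ 1 (hpos _)]
      rw [← ofReal_prod_of_nonneg (fun j _ => by have := hpos j; positivity),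
        ← ofReal_mul (by positivity), ← ofReal_mul (by positivity), ← ofReal_mul (by positivity)]
      congr 1
      rw [prod_mul_distrib, finsetProd_rpow _ _ fun j _ => (hpos j).le, prod_dixonMap h0 hI,
        div_rpow (by positivity) (by positivity), mul_rpow (by positivity) hc.le,
        rpow_two_mul_sub_one hvy, ← exp_sum]
      simp only [inv_one, one_mul, sum_neg_distrib, sum_dixonMap hy.injective]
      have h3 : u 0 ^ ((n + 1) * θ - 1) = u 0 ^ n * (u 0 ^ (n + 1)) ^ (θ - 1) := by
        rw [← Real.rpow_natCast, ← Real.rpow_natCast, ← rpow_mul h0.le, ← rpow_add h0]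
        congr 1
        push_cast
        ring
      have : 0 < (vdm y ^ 2) ^ (θ - 1) := by positivity
      rw [h3]
      field_simp
    · rw [Set.indicator_of_notMem
        (s := {u : Fin (n + 1) → ℝ | 0 < u 0 ∧ Interlace (fun i => u i.succ) y}) hu]
      rcases not_and_or.1 hu with h | h
      · rw [gammaDensity_of_nonpos _ _ h, zero_mul]
      · rw [Set.indicator_of_notMem (by exact h), mul_zero]
  · intro w hw
    simp only [Set.mem_ofPred_eq, not_forall] at hw
    obtain ⟨j, hj⟩ := hw
    exact prod_eq_zero (mem_univ j) (gammaDensity_of_nonpos θ 1 hj)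

end Integration

section Recursion

open ENNReal

lemma measurableSet_strictMono : MeasurableSet {y : Fin n → ℝ | StrictMono y} := by
  simp only [StrictMono, Set.ofPred_forall]
  exact .iInter fun i => .iInter fun j => .iInter fun _ =>
    measurableSet_lt (by fun_prop) (by fun_prop)

lemma lintegral_vdm_succ {θ t : ℝ} (hθ : 0 < θ) (ht : 0 < t) :
    (∫⁻ y in {y : Fin (n + 1) → ℝ | StrictMono y},
        ENNReal.ofReal (vdm y ^ (2 * θ) * gaussWeight t y)) * ENNReal.ofReal (Gamma θ) ^ (n + 1) =
      ENNReal.ofReal (Gamma ((n + 1) * θ)) *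
        (∫⁻ x in {x : Fin n → ℝ | StrictMono x},
          ENNReal.ofReal (vdm x ^ (2 * θ) * gaussWeight t x)) *
        (ENNReal.ofReal √(2 * π * t) * ENNReal.ofReal (t ^ θ * Gamma θ) ^ n) := by
  let F : (Fin n → ℝ) → (Fin (n + 1) → ℝ) → ℝ≥0∞ := fun x y =>
    {p : (Fin n → ℝ) × (Fin (n + 1) → ℝ) | Interlace p.1 p.2}.indicator
      (fun p => ENNReal.ofReal
        (vdm p.1 * vdm p.2 * cross p.1 p.2 ^ (θ - 1) * gaussWeight t p.2)) (x, y)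
  have hF : Measurable (Function.uncurry F) :=
    Measurable.indicator (by unfold vdm cross gaussWeight; fun_prop) measurableSet_interlace
  have hFx (x : Fin n → ℝ) (y) : F x y = {y | Interlace x y}.indicator (fun y =>
      ENNReal.ofReal (vdm x * vdm y * cross x y ^ (θ - 1) * gaussWeight t y)) y := rfl
  have hFy (x : Fin n → ℝ) (y) : F x y = {x | Interlace x y}.indicator (fun x =>
      ENNReal.ofReal (vdm x * vdm y * cross x y ^ (θ - 1) * gaussWeight t y)) x := rfl
  have hx (x : Fin n → ℝ) : ∫⁻ y, F x y = {x : Fin n → ℝ | StrictMono x}.indicator (fun x =>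
      ENNReal.ofReal (vdm x ^ (2 * θ) * gaussWeight t x) *
        (ENNReal.ofReal √(2 * π * t) * ENNReal.ofReal (t ^ θ * Gamma θ) ^ n)) x := by
    simp_rw [hFx]
    rw [lintegral_indicator (measurableSet_interlace_right x)]
    by_cases h : StrictMono x
    · have hv := vdm_pos h
      rw [Set.indicator_of_mem (by exact h), show 2 * θ = 1 + (2 * θ - 1) by ring,
        Real.rpow_add hv, Real.rpow_one, mul_assoc, ofReal_mul hv.le, mul_assoc,
        ← lintegral_interlace_right h hθ ht, ← lintegral_const_mul' _ _ ofReal_ne_top]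
      simp_rw [← ofReal_mul hv.le, mul_assoc]
    · rw [Set.indicator_of_notMem (by exact h), Set.eq_empty_of_forall_notMem
        (s := {y | Interlace x y}) fun y hy => h (Interlace.strictMono_left hy)]
      simp
  have hy (y : Fin (n + 1) → ℝ) : ENNReal.ofReal (Gamma ((n + 1) * θ)) * ∫⁻ x, F x y =
      {y : Fin (n + 1) → ℝ | StrictMono y}.indicator (fun y =>
        ENNReal.ofReal (vdm y ^ (2 * θ) * gaussWeight t y) *
          ENNReal.ofReal (Gamma θ) ^ (n + 1)) y := by
    simp_rw [hFy]
    rw [lintegral_indicator (measurableSet_interlace_left y)]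
    by_cases h : StrictMono y
    · have hv := vdm_pos h
      have hg := gaussWeight_pos t y
      have hvg : 0 ≤ vdm y * gaussWeight t y := by positivity
      rw [Set.indicator_of_mem (by exact h), show 2 * θ = 1 + (2 * θ - 1) by ring,
        Real.rpow_add hv, Real.rpow_one, mul_right_comm, ofReal_mul hvg, mul_assoc,
        ← lintegral_interlace_left h hθ, mul_left_comm,
        ← lintegral_const_mul' _ _ (ofReal_ne_top (r := vdm y * gaussWeight t y))]
      simp_rw [← ofReal_mul hvg]
      congr! 4
      ring
    · rw [Set.indicator_of_notMem (by exact h), Set.eq_empty_of_forall_notMem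
        (s := {x | Interlace x y}) fun x hx => h (Interlace.strictMono_right hx)]
      simp
  have key := lintegral_lintegral_swap (μ := volume) (ν := volume) hF.aemeasurable
  have hC : ENNReal.ofReal (Gamma θ) ^ (n + 1) ≠ ∞ := by finiteness
  have hD : ENNReal.ofReal √(2 * π * t) * ENNReal.ofReal (t ^ θ * Gamma θ) ^ n ≠ ∞ := by finiteness
  rw [← lintegral_mul_const' _ _ hC, ← lintegral_indicator measurableSet_strictMono, mul_assoc,
    ← lintegral_mul_const' _ _ hD, ← lintegral_indicator measurableSet_strictMono]
  simp_rw [← hx, ← hy]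
  rw [lintegral_const_mul' _ _ ofReal_ne_top, key]

lemma lintegral_vdm {θ t : ℝ} (hθ : 0 < θ) (ht : 0 < t) (n : ℕ) :
    ∫⁻ y in {y : Fin n → ℝ | StrictMono y},
        ENNReal.ofReal (vdm y ^ (2 * θ) * gaussWeight t y) =
      ENNReal.ofReal (t ^ (θ * n * ((n : ℝ) - 1) / 2 + n / 2) * (2 * π) ^ ((n : ℝ) / 2) *
        ∏ j : Fin n, Gamma (((j : ℕ) + 1) * θ) / Gamma θ) := by
  have hΓ := Gamma_pos_of_pos hθ
  induction n with
  | zero =>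
    have : {y : Fin 0 → ℝ | StrictMono y} = Set.univ :=
      Set.eq_univ_of_forall fun y => Subsingleton.strictMono y
    simp [this, vdm, gaussWeight, volume_pi]
  | succ n ih =>
    have h := lintegral_vdm_succ (n := n) hθ ht
    have hn : 0 < Gamma ((n + 1) * θ) := Gamma_pos_of_pos (by positivity)
    have hprod : 0 < ∏ j : Fin n, Gamma (((j : ℕ) + 1) * θ) / Gamma θ :=
      prod_pos fun j _ => div_pos (Gamma_pos_of_pos (by positivity)) hΓ
    have h0 : ENNReal.ofReal (Gamma θ) ^ (n + 1) ≠ 0 :=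
      pow_ne_zero _ (ENNReal.ofReal_pos.2 hΓ).ne'
    refine (ENNReal.mul_left_inj h0 (by finiteness)).1 (h.trans ?_)
    rw [ih, ← ofReal_pow hΓ.le, ← ofReal_pow (by positivity), ← ofReal_mul hn.le,
      ← ofReal_mul (by positivity), ← ofReal_mul (by positivity), ← ofReal_mul' (by positivity),
      Fin.prod_univ_castSucc]
    congr 1
    simp only [Fin.val_castSucc, Fin.val_last]
    have e1 : t ^ (θ * (n + 1 : ℕ) * (((n + 1 : ℕ) : ℝ) - 1) / 2 + (n + 1 : ℕ) / 2) =
        t ^ (θ * n * ((n : ℝ) - 1) / 2 + n / 2) * (t ^ θ) ^ n * t ^ (1 / 2 : ℝ) := by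
      rw [← Real.rpow_natCast, ← Real.rpow_mul ht.le, ← Real.rpow_add ht, ← Real.rpow_add ht]
      congr 1
      push_cast
      ring
    have e2 : (2 * π) ^ (((n + 1 : ℕ) : ℝ) / 2) =
        (2 * π) ^ ((n : ℝ) / 2) * (2 * π) ^ (1 / 2 : ℝ) := by
      rw [← Real.rpow_add (by positivity)]
      congr 1
      push_cast
      ring
    rw [e1, e2, Real.sqrt_eq_rpow, Real.mul_rpow (by positivity) ht.le, mul_pow]
    field_simp
    ring

lemma prod_rpow_eq_vdm_rpow {y : Fin n → ℝ} (hy : StrictMono y) (θ : ℝ) :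
    ∏ j, ∏ i ∈ Iio j, (y j - y i) ^ θ = vdm y ^ θ := by
  have h (j) : ∀ i ∈ Iio j, 0 ≤ y j - y i := fun i hi =>
    (sub_pos.2 (hy (mem_Iio.1 hi))).le
  rw [vdm, ← finsetProd_rpow _ _ fun j _ => prod_nonneg (h j)]
  exact prod_congr rfl fun j _ => finsetProd_rpow _ _ (h j) _

end Recursion

end HermiteBeta

/-- **Normalization of the Hermite β ensemble (Mehta-type Selberg integral).**
The integral over the open Weyl chamber `{y_1 < ⋯ < y_N}` of
`∏_{i<j}(y_j−y_i)^{2θ} ∏_i exp(−y_i²/(2t))` equals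
`t^{θN(N−1)/2+N/2} (2π)^{N/2} ∏_{j=1}^N Γ(jθ)/Γ(θ)`. -/
theorem hermite_beta_normalization (N : ℕ) (hN : 1 ≤ N) (θ t : ℝ) (hθ : 0 < θ) (ht : 0 < t) :
    (∫ y : Fin N → ℝ in {y | StrictMono y},
      (∏ j : Fin N, ∏ i ∈ Finset.Iio j, (y j - y i) ^ (2 * θ)) *
        ∏ i : Fin N, Real.exp (-(y i) ^ 2 / (2 * t)))
    = t ^ (θ * N * ((N : ℝ) - 1) / 2 + N / 2) * (2 * Real.pi) ^ ((N : ℝ) / 2) *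
        ∏ j : Fin N, Real.Gamma (((j : ℕ) + 1) * θ) / Real.Gamma θ := by
  have hprod : 0 < ∏ j : Fin N, Gamma (((j : ℕ) + 1) * θ) / Gamma θ :=
    Finset.prod_pos fun j _ =>
      div_pos (Gamma_pos_of_pos (by positivity)) (Gamma_pos_of_pos hθ)
  rw [setIntegral_congr_fun
      (g := fun y => HermiteBeta.vdm y ^ (2 * θ) * HermiteBeta.gaussWeight t y)
      HermiteBeta.measurableSet_strictMono fun y hy => by
        simp only [HermiteBeta.prod_rpow_eq_vdm_rpow hy, HermiteBeta.gaussWeight],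
    integral_eq_lintegral_of_nonneg_ae, HermiteBeta.lintegral_vdm hθ ht,
    ENNReal.toReal_ofReal (by positivity)]
  · filter_upwards [ae_restrict_mem HermiteBeta.measurableSet_strictMono] with y hy
    exact mul_nonneg (rpow_nonneg (HermiteBeta.vdm_pos hy).le _) (HermiteBeta.gaussWeight_pos t y).le
  · refine Measurable.aestronglyMeasurable ?_
    unfold HermiteBeta.vdm HermiteBeta.gaussWeight
    fun_prop
end
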